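/- arXiv:1310.0196 — 14 statements merged into one kernel-verified Lean document; each statement's English description precedes it below -/
import Mathlib

section
/- Let π be a finite projective plane of order q and n ≥ 2 a natural number. If the complete graph K_n embeds into π, then either q is even and n ≤ q+2, or q is odd and n ≤ q+1. -/
/-- `φ : V → P` is an embedding of the graph `G` into the projective plane with
points `P` and lines `L`. -/
def IsGraphEmbedding {V : Type*} (G : SimpleGraph V) (P L : Type*) [Membership P L]
    (φ : V → P) : Prop :=
  Function.Injective φ ∧
    ∀ e₁ ∈ G.edgeSet, ∀ e₂ ∈ G.edgeSet, ∀ ℓ : L,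
      (∀ v ∈ e₁, φ v ∈ ℓ) → (∀ v ∈ e₂, φ v ∈ ℓ) → e₁ = e₂

/-- A set of points is an arc if no line contains three of its points. -/
def IsArc {P : Type*} (L : Type*) [Membership P L] (S : Finset P) : Prop :=
  ∀ a ∈ S, ∀ b ∈ S, ∀ c ∈ S, ∀ l : L, a ∈ l → b ∈ l → c ∈ l → a ≠ b → a ≠ c → b = c

section Arc

open Configuration

variable {P L : Type*} [Membership P L]

lemma IsArc.injOn_line {S : Finset P} (hS : IsArc L S) {a : P} (ha : a ∈ S) {f : P → L}
    (hf : ∀ b, a ∈ f b ∧ b ∈ f b) : Set.InjOn f {b | b ∈ S ∧ b ≠ a} := by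
  rintro b ⟨hb, hba⟩ c ⟨hc, hca⟩ hbc
  exact hS a ha b hb c hc (f b) (hf b).1 (hf b).2 (hbc ▸ (hf c).2) hba.symm hca.symm

variable [ProjectivePlane P L]

lemma exists_line_mem_mem [Finite P] [Finite L] (a b : P) : ∃ l : L, a ∈ l ∧ b ∈ l := by
  by_cases hab : a = b
  · subst hab
    have hpos : 0 < lineCount L a := by
      have := ProjectivePlane.lineCount_eq (L := L) a
      omega
    obtain ⟨⟨l, hl⟩⟩ := (Nat.card_pos_iff.mp hpos).1
    exact ⟨l, hl, hl⟩
  · exact ⟨HasLines.mkLine hab, HasLines.mkLine_ax hab⟩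

open Classical in
lemma card_filter_lines_mem [Finite P] [Fintype L] (a : P) :
    (Finset.univ.filter fun l : L => a ∈ l).card = ProjectivePlane.order P L + 1 := by
  rw [← ProjectivePlane.lineCount_eq (L := L) a, lineCount, Nat.card_eq_fintype_card,
    Fintype.card_subtype]

lemma IsArc.card_le [Finite P] [Finite L] {S : Finset P} (hS : IsArc L S) :
    S.card ≤ ProjectivePlane.order P L + 2 := by
  classical
  have := Fintype.ofFinite L
  obtain rfl | ⟨a, ha⟩ := S.eq_empty_or_nonempty
  · simp
  choose f hf using exists_line_mem_mem (L := L) a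
  have hle : (S.erase a).card ≤ (Finset.univ.filter fun l : L => a ∈ l).card :=
    Finset.card_le_card_of_injOn f (fun b _ => by simpa using (hf b).1)
      ((hS.injOn_line ha hf).mono fun b hb => by simpa [and_comm] using hb)
  rw [card_filter_lines_mem, Finset.card_erase_of_mem ha] at hle
  omega

/-- A line meeting an arc of maximal size `q + 2` meets it in a second point. -/
lemma IsArc.exists_ne_mem [Finite P] [Finite L] {S : Finset P} (hS : IsArc L S)
    (hcard : S.card = ProjectivePlane.order P L + 2) {a : P} (ha : a ∈ S) {l : L} (hal : a ∈ l) :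
    ∃ b ∈ S, b ≠ a ∧ b ∈ l := by
  classical
  have := Fintype.ofFinite L
  choose f hf using exists_line_mem_mem (L := L) a
  have hsurj : Set.SurjOn f (S.erase a) (Finset.univ.filter fun l : L => a ∈ l) := by
    refine Finset.surjOn_of_injOn_of_card_le f (fun b _ => by simpa using (hf b).1)
      ((hS.injOn_line ha hf).mono fun b hb => by simpa [and_comm] using hb) ?_
    rw [card_filter_lines_mem, Finset.card_erase_of_mem ha]
    omega
  obtain ⟨b, hb, rfl⟩ := hsurj (show l ∈ _ by simpa using hal)
  rw [Finset.mem_coe, Finset.mem_erase] at hb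
  exact ⟨b, hb.2, hb.1, (hf b).2⟩

lemma IsArc.exists_notMem [Finite P] [Finite L] {S : Finset P} (hS : IsArc L S) :
    ∃ p, p ∉ S := by
  classical
  have := Fintype.ofFinite P
  by_contra! hall
  have hle := hS.card_le
  rw [Finset.eq_univ_iff_forall.mpr hall, Finset.card_univ,
    ProjectivePlane.card_points P L] at hle
  nlinarith [ProjectivePlane.one_lt_order P L]

/-- An arc of maximal size `q + 2` has evenly many points: the lines through a point outside
the arc partition it into pairs. -/
lemma IsArc.even_card [Finite P] [Finite L] {S : Finset P} (hS : IsArc L S)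
    (hcard : S.card = ProjectivePlane.order P L + 2) : Even S.card := by
  classical
  obtain ⟨p, hp⟩ := hS.exists_notMem
  choose f hf using exists_line_mem_mem (L := L) p
  have hline : ∀ {b l}, b ∈ S → p ∈ l → b ∈ l → f b = l := fun {b l} hb hpl hbl =>
    (Nondegenerate.eq_or_eq (hf b).1 (hf b).2 hpl hbl).resolve_left
      (by rintro rfl; exact hp hb)
  rw [Finset.card_eq_sum_card_image f S]
  refine Finset.even_sum _ fun l hl => ?_
  obtain ⟨a, ha, rfl⟩ := Finset.mem_image.mp hl
  obtain ⟨b, hb, hba, hbl⟩ := hS.exists_ne_mem hcard ha (hf a).2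
  have hfib : {c ∈ S | f c = f a} = {a, b} := by
    ext c
    simp only [Finset.mem_filter, Finset.mem_insert, Finset.mem_singleton]
    constructor
    · rintro ⟨hc, hca⟩
      by_contra! hne
      exact hne.2 (hS a ha b hb c hc (f a) (hf a).2 hbl (hca ▸ (hf c).2) hba.symm
        hne.1.symm).symm
    · rintro (rfl | rfl)
      · exact ⟨ha, rfl⟩
      · exact ⟨hb, hline hb (hf a).1 hbl⟩
  rw [hfib, Finset.card_pair hba.symm]
  exact even_two

end Arc

lemma IsGraphEmbedding.isArc_image {V P L : Type*} [Fintype V] [DecidableEq P] [Membership P L]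
    {φ : V → P} (hφ : IsGraphEmbedding (⊤ : SimpleGraph V) P L φ) :
    IsArc L (Finset.univ.image φ) := by
  simp only [IsArc, Finset.mem_image, Finset.mem_univ, true_and, forall_exists_index,
    forall_apply_eq_imp_iff]
  intro i j k l hi hj hk hij hik
  have h := hφ.2 s(i, j) (by simpa using fun h => hij (congrArg φ h))
    s(i, k) (by simpa using fun h => hik (congrArg φ h)) l
    (by simp [hi, hj]) (by simp [hi, hk])
  rw [Sym2.congr_right.mp h]

/-- If the complete graph `K_n` (`n ≥ 2`) embeds into a finite projective plane of order `q`,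
then either `q` is even and `n ≤ q + 2`, or `q` is odd and `n ≤ q + 1`. -/
theorem completeGraph_embedding_order_bound {P L : Type*} [Fintype P] [Fintype L]
    [Membership P L] [Configuration.ProjectivePlane P L] (n q : ℕ) (hn : 2 ≤ n)
    (hq : Configuration.ProjectivePlane.order P L = q)
    (h : ∃ φ : Fin n → P, IsGraphEmbedding (⊤ : SimpleGraph (Fin n)) P L φ) :
    (Even q ∧ n ≤ q + 2) ∨ (Odd q ∧ n ≤ q + 1) := by
  classical
  obtain ⟨φ, hφ⟩ := h
  subst hq
  have hS := hφ.isArc_image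
  have hcard : (Finset.univ.image φ).card = n := by
    rw [Finset.card_image_of_injective _ hφ.1, Finset.card_univ, Fintype.card_fin]
  have hle := hS.card_le
  have heven := hS.even_card
  rw [hcard] at hle heven
  rcases Nat.even_or_odd (Configuration.ProjectivePlane.order P L) with hq | hq
  · exact Or.inl ⟨hq, hle⟩
  · refine Or.inr ⟨hq, ?_⟩
    by_contra! hlt
    have hn' : n = Configuration.ProjectivePlane.order P L + 2 := by omega
    have := heven hn'
    grind
end

section
/- Let n be a natural number and let π be any finite projective plane of order q with 2q ≥ n(n-1). Then the complete graph K_n embeds into π. -/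
open Configuration ProjectivePlane in
/-- A point avoiding a small set of points and a small set of lines. -/
theorem exists_point_notMem_of_card_lt {P L : Type*} [Fintype P] [Fintype L] [Membership P L]
    [ProjectivePlane P L] (S : Finset P) (T : Finset L)
    (h : S.card + T.card ≤ order P L) : ∃ p, p ∉ S ∧ ∀ ℓ ∈ T, p ∉ ℓ := by
  classical
  have hline (ℓ : L) : (Finset.univ.filter (fun p : P => p ∈ ℓ)).card = order P L + 1 := by
    rw [← pointCount_eq P ℓ, pointCount, Nat.card_eq_fintype_card, Fintype.card_subtype]
  have hcard : (S ∪ T.biUnion fun ℓ => Finset.univ.filter (fun p : P => p ∈ ℓ)).card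
      < Fintype.card P := by
    have h₁ := Finset.card_union_le S
      (T.biUnion fun ℓ => Finset.univ.filter (fun p : P => p ∈ ℓ))
    have h₂ := Finset.card_biUnion_le_card_mul T
      (fun ℓ => Finset.univ.filter (fun p : P => p ∈ ℓ)) (order P L + 1)
      fun ℓ _ => (hline ℓ).le
    rw [card_points P L]
    nlinarith
  obtain ⟨p, hp⟩ : ∃ p, p ∉ S ∪ T.biUnion fun ℓ => Finset.univ.filter (fun p : P => p ∈ ℓ) := by
    by_contra! hall
    rw [Finset.eq_univ_iff_forall.mpr hall, Finset.card_univ] at hcard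
    exact hcard.false
  simp only [Finset.mem_union, Finset.mem_biUnion, Finset.mem_filter, Finset.mem_univ, true_and,
    not_or, not_exists, not_and] at hp
  exact ⟨p, hp⟩

open Configuration ProjectivePlane in
/-- A `k`-arc together with a set of at most `k.choose 2` lines containing all its secants. -/
theorem exists_arc_of_choose_two_le_order {P L : Type*} [Fintype P] [Fintype L] [Membership P L]
    [ProjectivePlane P L] (k : ℕ) (h : k.choose 2 ≤ order P L) :
    ∃ (S : Finset P) (T : Finset L), S.card = k ∧ T.card ≤ k.choose 2 ∧
      (∀ a ∈ S, ∀ b ∈ S, a ≠ b → ∀ ℓ : L, a ∈ ℓ → b ∈ ℓ → ℓ ∈ T) ∧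
      ∀ a ∈ S, ∀ b ∈ S, ∀ c ∈ S, ∀ ℓ : L, a ∈ ℓ → b ∈ ℓ → c ∈ ℓ → a = b ∨ a = c ∨ b = c := by
  classical
  induction k with
  | zero => exact ⟨∅, ∅, by simp⟩
  | succ k ih =>
    have hchoose : (k + 1).choose 2 = k + k.choose 2 := by
      rw [Nat.choose_succ_succ' k 1, Nat.choose_one_right]
    obtain ⟨S, T, hS, hT, hsec, harc⟩ := ih (by omega)
    obtain ⟨p, hpS, hpT⟩ := exists_point_notMem_of_card_lt S T (by omega)
    have hunique (s : P) : ∃ ℓ : L, s ≠ p → ∀ m : L, s ∈ m → p ∈ m → m = ℓ := by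
      by_cases hs : s = p
      · obtain ⟨ℓ, -⟩ := Nondegenerate.exists_line (L := L) p
        exact ⟨ℓ, fun hne => absurd hs hne⟩
      · obtain ⟨ℓ, -, hℓ⟩ := HasLines.existsUnique_line P L s p hs
        exact ⟨ℓ, fun _ m hsm hpm => hℓ m ⟨hsm, hpm⟩⟩
    choose f hf using hunique
    have hmem {s : P} (hs : s ∈ S) {m : L} (hsm : s ∈ m) (hpm : p ∈ m) : m ∈ S.image f :=
      Finset.mem_image.mpr
        ⟨s, hs, (hf s (ne_of_mem_of_not_mem hs hpS) m hsm hpm).symm⟩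
    refine ⟨insert p S, S.image f ∪ T, ?_, ?_, ?_, ?_⟩
    · rw [Finset.card_insert_of_notMem hpS, hS]
    · have h₁ := Finset.card_union_le (S.image f) T
      have h₂ := Finset.card_image_le (s := S) (f := f)
      omega
    · intro a ha b hb hab ℓ haℓ hbℓ
      rw [Finset.mem_union]
      rcases Finset.mem_insert.mp ha with rfl | haS <;>
        rcases Finset.mem_insert.mp hb with rfl | hbS
      · exact absurd rfl hab
      · exact Or.inl (hmem hbS hbℓ haℓ)
      · exact Or.inl (hmem haS haℓ hbℓ)
      · exact Or.inr (hsec a haS b hbS hab ℓ haℓ hbℓ)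
    · have hnew {a b : P} (ha : a ∈ S) (hb : b ∈ S) {ℓ : L} (haℓ : a ∈ ℓ) (hbℓ : b ∈ ℓ)
          (hpℓ : p ∈ ℓ) : a = b := by
        by_contra hab
        exact hpT ℓ (hsec a ha b hb hab ℓ haℓ hbℓ) hpℓ
      intro a ha b hb c hc ℓ haℓ hbℓ hcℓ
      simp only [Finset.mem_insert] at ha hb hc
      grind

/-- If `π` is any finite projective plane of order `q` with `2q ≥ n(n-1)`, then the complete
graph `K_n` embeds into `π`. -/
theorem completeGraph_embeds_of_large_order {P L : Type*} [Fintype P] [Fintype L]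
    [Membership P L] [Configuration.ProjectivePlane P L] (n q : ℕ)
    (hq : Configuration.ProjectivePlane.order P L = q) (h : n * (n - 1) ≤ 2 * q) :
    ∃ φ : Fin n → P, IsGraphEmbedding (⊤ : SimpleGraph (Fin n)) P L φ := by
  obtain ⟨S, -, hS, -, -, harc⟩ := exists_arc_of_choose_two_le_order (P := P) (L := L) n
    (by rw [Nat.choose_two_right, hq]; omega)
  let e := (S.equivFinOfCardEq hS).symm
  have hinj : Function.Injective fun i => (e i : P) := Subtype.val_injective.comp e.injective
  refine ⟨fun i => e i, hinj, fun e₁ he₁ e₂ he₂ ℓ h₁ h₂ => ?_⟩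
  have key {i j k : Fin n} (hi : (e i : P) ∈ ℓ) (hj : (e j : P) ∈ ℓ) (hk : (e k : P) ∈ ℓ) :
      i = j ∨ i = k ∨ j = k :=
    (harc _ (e i).2 _ (e j).2 _ (e k).2 ℓ hi hj hk).imp (@hinj _ _)
      (Or.imp (@hinj _ _) (@hinj _ _))
  induction e₁ with | _ a b
  induction e₂ with | _ c d
  simp only [SimpleGraph.mem_edgeSet, SimpleGraph.top_adj] at he₁ he₂
  simp only [Sym2.mem_iff, forall_eq_or_imp, forall_eq] at h₁ h₂
  have hc := key h₁.1 h₁.2 h₂.1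
  have hd := key h₁.1 h₁.2 h₂.2
  rw [Sym2.eq_iff]
  grind
end

section
/- Let G be a finite simple graph with v vertices and let π be any finite projective plane of order q with 2q ≥ v(v-1). Then G embeds into π. -/
namespace Configuration.ProjectivePlane

variable {P L : Type*} [Fintype P] [Fintype L] [Membership P L] [ProjectivePlane P L]

/-- A set of at most `order P L` lines does not cover a finite projective plane. -/
theorem exists_point_forall_notMem (T : Finset L) (hT : T.card ≤ order P L) :
    ∃ p : P, ∀ l ∈ T, p ∉ l := by
  classical
  by_contra! hcon
  have huniv : (Finset.univ : Finset P) ⊆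
      T.biUnion fun l => Finset.univ.filter fun p : P => p ∈ l := by
    intro p _
    obtain ⟨l, hl, hp⟩ := hcon p
    simpa using ⟨l, hl, hp⟩
  have hcard := (Finset.card_le_card huniv).trans
    (Finset.card_biUnion_le_card_mul _ _ (order P L + 1) fun l _ => by
      rw [← pointCount_eq P l, pointCount, Nat.card_eq_fintype_card, Fintype.card_subtype])
  rw [Finset.card_univ, card_points P L] at hcard
  nlinarith

variable (L) in
/-- Any two points, equal or not, lie on a common line. -/
theorem exists_line_mem_mem (a b : P) : ∃ l : L, a ∈ l ∧ b ∈ l := by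
  by_cases hab : a = b
  · subst hab
    obtain ⟨l, -⟩ := Nondegenerate.exists_line (L := L) a
    have hpos : 0 < lineCount L a := by rw [lineCount_eq L a]; omega
    obtain ⟨⟨l, hl⟩⟩ := (Nat.card_pos_iff.mp hpos).1
    exact ⟨l, hl, hl⟩
  · exact ⟨_, HasLines.mkLine_ax hab⟩

variable (P L) in
/-- A projective plane of order at least `k.choose 2` contains a `k`-arc. -/
theorem exists_arc (k : ℕ) (hk : k.choose 2 ≤ order P L) :
    ∃ s : Finset P, s.card = k ∧ ∀ a ∈ s, ∀ b ∈ s, ∀ c ∈ s, ∀ l : L,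
      a ∈ l → b ∈ l → c ∈ l → a = b ∨ a = c ∨ b = c := by
  classical
  induction k with
  | zero => exact ⟨∅, by simp⟩
  | succ k ih =>
    obtain ⟨s, hs, harc⟩ := ih ((Nat.choose_le_choose 2 k.le_succ).trans hk)
    have hline (e : Sym2 P) : ∃ l : L, ∀ p ∈ e, p ∈ l := by
      induction e with
      | _ a b => simpa using exists_line_mem_mem L a b
    choose F hF using hline
    obtain ⟨p, hp⟩ := exists_point_forall_notMem (s.sym2.image F)
      (Finset.card_image_le.trans (by rwa [Finset.card_sym2, hs]))
    have hsec (a) (ha : a ∈ s) (b) (hb : b ∈ s) (l : L) (hal : a ∈ l) (hbl : b ∈ l)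
        (hpl : p ∈ l) : a = b := by
      have hab := hF s(a, b)
      refine (Nondegenerate.eq_or_eq hal hbl (hab a (by simp)) (hab b (by simp))).resolve_right ?_
      rintro rfl
      exact hp _ (Finset.mem_image_of_mem F (by simp [ha, hb])) hpl
    have hps : p ∉ s := fun h =>
      hp _ (Finset.mem_image_of_mem F (a := s(p, p)) (by simp [h])) (hF _ p (by simp))
    refine ⟨insert p s, by rw [Finset.card_insert_of_notMem hps, hs], ?_⟩
    intro a ha b hb c hc l hal hbl hcl
    rw [Finset.mem_insert] at ha hb hc
    grind

end Configuration.ProjectivePlane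

/-- Every finite simple graph `G` with `v` vertices embeds into any finite projective plane
of order `q` with `2q ≥ v(v-1)`. -/
theorem graph_embeds_of_large_order {V P L : Type*} [Fintype V] [Fintype P] [Fintype L]
    [Membership P L] [Configuration.ProjectivePlane P L] (G : SimpleGraph V) (v q : ℕ)
    (hv : Fintype.card V = v)
    (hq : Configuration.ProjectivePlane.order P L = q) (h : v * (v - 1) ≤ 2 * q) :
    ∃ φ : V → P, IsGraphEmbedding G P L φ := by
  subst hv hq
  obtain ⟨s, hs, harc⟩ := Configuration.ProjectivePlane.exists_arc P L (Fintype.card V)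
    (by rw [Nat.choose_two_right]; omega)
  let φ : V ≃ s := Fintype.equivOfCardEq (by simp [hs])
  have hφ : Function.Injective fun x => (φ x : P) := Subtype.val_injective.comp φ.injective
  have harcV (a b c : V) (l : L) (ha : (φ a : P) ∈ l) (hb : (φ b : P) ∈ l)
      (hc : (φ c : P) ∈ l) : a = b ∨ a = c ∨ b = c := by
    simpa only [hφ.eq_iff] using harc _ (φ a).2 _ (φ b).2 _ (φ c).2 l ha hb hc
  refine ⟨fun x => φ x, hφ, fun e₁ he₁ e₂ he₂ l h₁ h₂ => ?_⟩
  induction e₁ with | _ a b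
  induction e₂ with | _ c d
  have hab := G.ne_of_adj he₁
  have hcd := G.ne_of_adj he₂
  simp only [Sym2.mem_iff, forall_eq_or_imp, forall_eq] at h₁ h₂
  have h₃ := harcV a b c l h₁.1 h₁.2 h₂.1
  have h₄ := harcV a b d l h₁.1 h₁.2 h₂.2
  rw [Sym2.eq_iff]
  grind
end

section
/- Let n be a natural number and let G be any simple graph that is a subgraph of the complete bipartite graph K_{n,n}. Then G embeds into every finite projective plane π of order q with q ≥ n. -/
open Configuration Nondegenerate in
/-- A line of a projective plane of order `q ≥ n` contains `n` points distinct from any given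
point of that line. -/
theorem exists_injective_mem_line_ne {P L : Type*} [Finite P] [Finite L] [Membership P L]
    [ProjectivePlane P L] {n : ℕ} (hn : n ≤ ProjectivePlane.order P L) {l : L} {x : P}
    (hx : x ∈ l) : ∃ f : Fin n → P, Function.Injective f ∧ ∀ i, f i ∈ l ∧ f i ≠ x := by
  classical
  cases nonempty_fintype P
  have hcard : ProjectivePlane.order P L + 1 = Fintype.card {p : P // p ∈ l} := by
    rw [← ProjectivePlane.pointCount_eq P l, pointCount, Nat.card_eq_fintype_card]
  have hle : Fintype.card (Fin n) ≤
      Fintype.card {p : {p : P // p ∈ l} // p ≠ ⟨x, hx⟩} := by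
    rw [Fintype.card_fin, Fintype.card_subtype_compl, Fintype.card_subtype_eq]
    omega
  obtain ⟨f⟩ := Function.Embedding.nonempty_of_card_le hle
  exact ⟨fun i => (f i).1.1, fun i j h => f.injective (Subtype.ext (Subtype.ext h)),
    fun i => ⟨(f i).1.2, fun h => (f i).2 (Subtype.ext h)⟩⟩

theorem IsGraphEmbedding.mono {V P L : Type*} [Membership P L] {G H : SimpleGraph V} (h : G ≤ H)
    {φ : V → P} (hφ : IsGraphEmbedding H P L φ) : IsGraphEmbedding G P L φ :=
  ⟨hφ.1, fun e₁ h₁ e₂ h₂ => hφ.2 e₁ (SimpleGraph.edgeSet_mono h h₁) e₂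
    (SimpleGraph.edgeSet_mono h h₂)⟩

theorem exists_eq_of_mem_edgeSet_completeBipartiteGraph {U V : Type*} {e : Sym2 (U ⊕ V)}
    (he : e ∈ (completeBipartiteGraph U V).edgeSet) :
    ∃ u v, e = s(Sum.inl u, Sum.inr v) := by
  induction e with
  | h a b =>
    rcases a with a | a <;> rcases b with b | b <;> simp at he ⊢

open Configuration Nondegenerate in
/-- Placing the two classes of a complete bipartite graph on two distinct lines, away from their
intersection point, gives an embedding. -/
theorem isGraphEmbedding_completeBipartiteGraph {U V P L : Type*} [Membership P L]
    [Nondegenerate P L] {l m : L} (hlm : l ≠ m) {x : P} (hxl : x ∈ l) (hxm : x ∈ m)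
    {f : U → P} (hf : Function.Injective f) (hfl : ∀ u, f u ∈ l ∧ f u ≠ x)
    {g : V → P} (hg : Function.Injective g) (hgm : ∀ v, g v ∈ m ∧ g v ≠ x) :
    IsGraphEmbedding (completeBipartiteGraph U V) P L (Sum.elim f g) := by
  have hfm : ∀ u, f u ∉ m := fun u hu =>
    (eq_or_eq (hfl u).1 hxl hu hxm).elim (hfl u).2 hlm
  have hgl : ∀ v, g v ∉ l := fun v hv =>
    (eq_or_eq hv hxl (hgm v).1 hxm).elim (hgm v).2 hlm
  refine ⟨hf.sumElim hg fun u v h => hfm u (h ▸ (hgm v).1), fun e₁ h₁ e₂ h₂ ℓ k₁ k₂ => ?_⟩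
  obtain ⟨u, v, rfl⟩ := exists_eq_of_mem_edgeSet_completeBipartiteGraph h₁
  obtain ⟨u', v', rfl⟩ := exists_eq_of_mem_edgeSet_completeBipartiteGraph h₂
  have hu : f u ∈ ℓ := k₁ (Sum.inl u) (by simp)
  have hv : g v ∈ ℓ := k₁ (Sum.inr v) (by simp)
  have hu' : f u' ∈ ℓ := k₂ (Sum.inl u') (by simp)
  have hv' : g v' ∈ ℓ := k₂ (Sum.inr v') (by simp)
  have huu : u = u' := hf <| (eq_or_eq hu hu' (hfl u).1 (hfl u').1).resolve_right
    fun h => hgl v (h ▸ hv)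
  have hvv : v = v' := hg <| (eq_or_eq hv hv' (hgm v).1 (hgm v').1).resolve_right
    fun h => hfm u (h ▸ hu)
  rw [huu, hvv]

/-- Any subgraph `G` of the complete bipartite graph `K_{n,n}` embeds into every finite
projective plane of order `q ≥ n`. -/
theorem subgraph_of_completeBipartite_embeds {P L : Type*} [Fintype P] [Fintype L]
    [Membership P L] [Configuration.ProjectivePlane P L] (n q : ℕ)
    (G : SimpleGraph (Fin n ⊕ Fin n)) (hG : G ≤ completeBipartiteGraph (Fin n) (Fin n))
    (hq : Configuration.ProjectivePlane.order P L = q) (hqn : n ≤ q) :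
    ∃ φ : Fin n ⊕ Fin n → P, IsGraphEmbedding G P L φ := by
  obtain ⟨p₁, p₂, -, l, m, -, -, -, hl, hm, -⟩ :=
    Configuration.ProjectivePlane.exists_config (P := P) (L := L)
  have hlm : l ≠ m := fun h => hl (h ▸ hm)
  obtain ⟨hxl, hxm⟩ := Configuration.HasPoints.mkPoint_ax (P := P) hlm
  obtain ⟨f, hf, hfl⟩ := exists_injective_mem_line_ne (hqn.trans_eq hq.symm) hxl
  obtain ⟨g, hg, hgm⟩ := exists_injective_mem_line_ne (hqn.trans_eq hq.symm) hxm
  exact ⟨Sum.elim f g,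
    (isGraphEmbedding_completeBipartiteGraph hlm hxl hxm hf hfl hg hgm).mono hG⟩
end

section
/- Let π be a finite projective plane of order q and let m ≥ n ≥ 1 be natural numbers. The complete bipartite graph K_{m,n} embeds into π if and only if either m ≤ q and n ≤ q, or n = 1 and m = q+1. -/
/-- An embedding of a complete bipartite graph, in terms of its restrictions to the two classes. -/
theorem isGraphEmbedding_completeBipartiteGraph_iff {V W P L : Type*} [Membership P L]
    (φ : V ⊕ W → P) :
    IsGraphEmbedding (completeBipartiteGraph V W) P L φ ↔
      Function.Injective φ ∧ ∀ i i' j j' (l : L), φ (.inl i) ∈ l → φ (.inr j) ∈ l →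
        φ (.inl i') ∈ l → φ (.inr j') ∈ l → i = i' ∧ j = j' := by
  refine and_congr_right fun _ => ⟨fun h i i' j j' l hi hj hi' hj' => ?_, fun h => ?_⟩
  · have := h s(.inl i, .inr j) (by simp) s(.inl i', .inr j') (by simp) l
      (by simp [hi, hj]) (by simp [hi', hj'])
    simpa using this
  · have key : ∀ e ∈ (completeBipartiteGraph V W).edgeSet, ∃ i j, e = s(.inl i, .inr j) := by
      intro e
      induction e with | _ x y =>
      rcases x with x | x <;> rcases y with y | y <;> simp
    intro e he e' he' l hl hl'
    obtain ⟨i, j, rfl⟩ := key e he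
    obtain ⟨i', j', rfl⟩ := key e' he'
    obtain ⟨rfl, rfl⟩ := h i i' j j' l (hl _ (by simp)) (hl _ (by simp))
      (hl' _ (by simp)) (hl' _ (by simp))
    rfl

namespace Configuration.ProjectivePlane

variable {P L : Type*} [Membership P L] [ProjectivePlane P L]

/-- The lines joining the centre of an embedded star to its leaves are distinct. -/
theorem exists_injective_line_of_isGraphEmbedding {V W : Type*} {φ : V ⊕ W → P}
    (h : IsGraphEmbedding (completeBipartiteGraph V W) P L φ) (j : W) :
    ∃ f : V → {l : L // φ (.inr j) ∈ l}, Function.Injective f ∧ ∀ i, φ (.inl i) ∈ (f i).1 := by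
  rw [isGraphEmbedding_completeBipartiteGraph_iff] at h
  have hne (i : V) : φ (.inl i) ≠ φ (.inr j) := fun e => by simpa using h.1 e
  refine ⟨fun i => ⟨HasLines.mkLine (hne i), (HasLines.mkLine_ax (hne i)).2⟩, fun i i' e => ?_,
    fun i => (HasLines.mkLine_ax (hne i)).1⟩
  have e : (HasLines.mkLine (hne i) : L) = HasLines.mkLine (hne i') := congrArg Subtype.val e
  have hi' := HasLines.mkLine_ax (L := L) (hne i')
  have hi := HasLines.mkLine_ax (L := L) (hne i)
  exact (h.2 i i' j j _ hi.1 hi.2 (e ▸ hi'.1) hi.2).1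

variable [Finite P] [Finite L]

theorem card_le_of_isGraphEmbedding {V W : Type*} {φ : V ⊕ W → P}
    (h : IsGraphEmbedding (completeBipartiteGraph V W) P L φ) (j : W) :
    Nat.card V ≤ order P L + 1 := by
  obtain ⟨f, hf, -⟩ := exists_injective_line_of_isGraphEmbedding h j
  rw [← lineCount_eq L (φ (.inr j))]
  exact Nat.card_le_card_of_injective f hf

/-- If one class has `order P L + 1` vertices, then the other has at most one vertex. -/
theorem subsingleton_of_isGraphEmbedding {V W : Type*} {φ : V ⊕ W → P}
    (h : IsGraphEmbedding (completeBipartiteGraph V W) P L φ)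
    (hV : Nat.card V = order P L + 1) : Subsingleton W := by
  refine ⟨fun j j' => by_contra fun hj => ?_⟩
  have hne : φ (.inr j) ≠ φ (.inr j') := fun e => hj (by simpa using h.1 e)
  have hsurj (k : W) (l : L) (hl : φ (.inr k) ∈ l) : ∃ i, φ (.inl i) ∈ l := by
    obtain ⟨f, hf, hfi⟩ := exists_injective_line_of_isGraphEmbedding h k
    have hb := hf.bijective_of_nat_card_le (by
      rw [hV, ← lineCount_eq L (φ (.inr k))]; exact le_rfl)
    obtain ⟨i, hi⟩ := hb.2 ⟨l, hl⟩
    exact ⟨i, by simpa [hi] using hfi i⟩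
  obtain ⟨hl, hl'⟩ := HasLines.mkLine_ax (L := L) hne
  obtain ⟨i, hi⟩ := hsurj j _ hl
  obtain ⟨i', hi'⟩ := hsurj j' _ hl'
  exact hj (((isGraphEmbedding_completeBipartiteGraph_iff φ).1 h).2 i i' j j' _ hi hl hi' hl').2

theorem card_points_on_line_ne {p : P} {l : L} (hp : p ∈ l) :
    Nat.card {x : P // x ∈ l ∧ x ≠ p} = order P L := by
  have h : ({x : P | x ∈ l} \ {p}).ncard = order P L := by
    rw [Set.ncard_sdiff_singleton_of_mem (show p ∈ {x : P | x ∈ l} from hp)]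
    exact Nat.sub_eq_of_eq_add (pointCount_eq P l)
  rw [← h]
  rfl

variable (P L)

/-- Two lines without their common point carry the two classes of a complete bipartite graph. -/
theorem exists_isGraphEmbedding_of_le {m n : ℕ} (hm : m ≤ order P L) (hn : n ≤ order P L) :
    ∃ φ : Fin m ⊕ Fin n → P, IsGraphEmbedding (completeBipartiteGraph (Fin m) (Fin n)) P L φ := by
  obtain ⟨-, p₂, -, l₁, l₂, -, -, -, h₂₁, h₂₂, -⟩ := @exists_config P L _ _
  have hne : l₁ ≠ l₂ := fun e => h₂₁ (e ▸ h₂₂)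
  obtain ⟨p, hp₁, hp₂⟩ : ∃ p : P, p ∈ l₁ ∧ p ∈ l₂ := ⟨_, HasPoints.mkPoint_ax hne⟩
  have points (l : L) (hl : p ∈ l) {k : ℕ} (hk : k ≤ order P L) :
      ∃ a : Fin k → P, Function.Injective a ∧ ∀ i, a i ∈ l ∧ a i ≠ p := by
    let e := Finite.equivFinOfCardEq (card_points_on_line_ne hl)
    exact ⟨fun i => (e.symm (Fin.castLE hk i)).1,
      Subtype.val_injective.comp (e.symm.injective.comp (Fin.castLE_injective hk)),
      fun i => (e.symm (Fin.castLE hk i)).2⟩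
  obtain ⟨a, ha, hal⟩ := points l₁ hp₁ hm
  obtain ⟨b, hb, hbl⟩ := points l₂ hp₂ hn
  have ha₂ (i) : a i ∉ l₂ := fun h =>
    (Nondegenerate.eq_or_eq (hal i).1 hp₁ h hp₂).elim (hal i).2 hne
  have hb₁ (j) : b j ∉ l₁ := fun h =>
    (Nondegenerate.eq_or_eq h hp₁ (hbl j).1 hp₂).elim (hbl j).2 hne
  refine ⟨Sum.elim a b, (isGraphEmbedding_completeBipartiteGraph_iff _).2
    ⟨ha.sumElim hb fun i j e => ha₂ i (e ▸ (hbl j).1), fun i i' j j' l hi hj hi' hj' => ?_⟩⟩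
  simp only [Sum.elim_inl, Sum.elim_inr] at hi hj hi' hj'
  exact ⟨ha ((Nondegenerate.eq_or_eq hi hi' (hal i).1 (hal i').1).resolve_right
      fun e => hb₁ j (e ▸ hj)),
    hb ((Nondegenerate.eq_or_eq hj hj' (hbl j).1 (hbl j').1).resolve_right
      fun e => ha₂ i (e ▸ hi))⟩

/-- A star embeds with one leaf on each line through its centre. -/
theorem exists_isGraphEmbedding_star :
    ∃ φ : Fin (order P L + 1) ⊕ Fin 1 → P,
      IsGraphEmbedding (completeBipartiteGraph (Fin (order P L + 1)) (Fin 1)) P L φ := by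
  obtain ⟨p, -⟩ := @exists_config P L _ _
  let e := Finite.equivFinOfCardEq (lineCount_eq L p)
  have leaf (l : {l : L // p ∈ l}) : ∃ x : P, x ∈ l.1 ∧ x ≠ p := by
    have : 0 < Nat.card {x : P // x ∈ l.1 ∧ x ≠ p} := by
      rw [card_points_on_line_ne l.2]
      exact zero_lt_one.trans (one_lt_order P L)
    exact nonempty_subtype.1 (Nat.card_pos_iff.1 this).1
  choose x hx hxp using leaf
  have hline (i : {l : L // p ∈ l}) (l : L) (hl : p ∈ l) (h : x i ∈ l) : i.1 = l :=
    (Nondegenerate.eq_or_eq (hx i) i.2 h hl).resolve_left (hxp i)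
  have hxinj : Function.Injective x := fun i i' h =>
    Subtype.ext (hline i i'.1 i'.2 (h ▸ hx i'))
  refine ⟨Sum.elim (x ∘ e.symm) fun _ => p, (isGraphEmbedding_completeBipartiteGraph_iff _).2
    ⟨(hxinj.comp e.symm.injective).sumElim (Function.injective_of_subsingleton _)
      fun i _ => hxp _, fun i i' j j' l hi hj hi' _ => ⟨?_, Subsingleton.elim _ _⟩⟩⟩
  exact e.symm.injective (Subtype.ext ((hline _ l hj hi).trans (hline _ l hj hi').symm))

end Configuration.ProjectivePlane

/-- For `m ≥ n ≥ 1`, the complete bipartite graph `K_{m,n}` embeds into a finite projective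
plane of order `q` if and only if `m ≤ q` and `n ≤ q`, or `n = 1` and `m = q + 1`. -/
theorem completeBipartite_embeds_iff {P L : Type*} [Fintype P] [Fintype L]
    [Membership P L] [Configuration.ProjectivePlane P L] (m n q : ℕ)
    (hmn : n ≤ m) (hn : 1 ≤ n)
    (hq : Configuration.ProjectivePlane.order P L = q) :
    (∃ φ : Fin m ⊕ Fin n → P,
        IsGraphEmbedding (completeBipartiteGraph (Fin m) (Fin n)) P L φ) ↔
      ((m ≤ q ∧ n ≤ q) ∨ (n = 1 ∧ m = q + 1)) := by
  subst hq
  constructor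
  · rintro ⟨φ, h⟩
    have hm := Configuration.ProjectivePlane.card_le_of_isGraphEmbedding h ⟨0, hn⟩
    rw [Nat.card_fin] at hm
    rcases hm.lt_or_eq with hlt | heq
    · left
      omega
    · have := Configuration.ProjectivePlane.subsingleton_of_isGraphEmbedding h (by rw [Nat.card_fin, heq])
      have := Fin.subsingleton_iff_le_one.1 this
      right
      omega
  · rintro (⟨hm, hn⟩ | ⟨rfl, rfl⟩)
    · exact Configuration.ProjectivePlane.exists_isGraphEmbedding_of_le P L hm hn
    · exact Configuration.ProjectivePlane.exists_isGraphEmbedding_star P L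
end

section
/- Let π be a finite projective plane of order q and let n be a natural number with 1 ≤ n ≤ q+1. Then the number of embeddings of the star graph K_{1,n} into π equals (q²+q+1) · C(q+1, n) · qⁿ · n!, where C(q+1,n) denotes the binomial coefficient. -/
open Configuration in
/-- A line through `p` contains `q` points other than `p`, where `q` is the order. -/
theorem card_mem_line_ne {P L : Type*} [Finite P] [Finite L] [Membership P L]
    [ProjectivePlane P L] {p : P} {l : L} (hp : p ∈ l) :
    Nat.card {x : P // x ∈ l ∧ x ≠ p} = ProjectivePlane.order P L := by
  have h : ({x : P | x ∈ l} \ {p}).ncard + 1 = {x : P | x ∈ l}.ncard :=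
    Set.ncard_sdiff_singleton_add_one hp
  have h' : {x : P | x ∈ l}.ncard = ProjectivePlane.order P L + 1 :=
    ProjectivePlane.pointCount_eq P l
  exact Nat.succ_injective (h.trans h')

/-- A map is an embedding of a star iff the leaves avoid the center and distinct leaves lie on
distinct lines through the center. -/
theorem isGraphEmbedding_star_iff {P L : Type*} [Membership P L]
    [Configuration.HasLines P L] {n : ℕ} {φ : Fin 1 ⊕ Fin n → P} :
    IsGraphEmbedding (completeBipartiteGraph (Fin 1) (Fin n)) P L φ ↔
      (∀ i, φ (.inr i) ≠ φ (.inl 0)) ∧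
        ∀ i j, ∀ l : L, φ (.inl 0) ∈ l → φ (.inr i) ∈ l → φ (.inr j) ∈ l → i = j := by
  have edge {e : Sym2 (Fin 1 ⊕ Fin n)}
      (he : e ∈ (completeBipartiteGraph (Fin 1) (Fin n)).edgeSet) :
      ∃ i, e = s(.inl 0, .inr i) := by
    induction e with | h a b =>
    rcases a with a | a <;> rcases b with b | b <;> simp_all [Subsingleton.elim _ (0 : Fin 1)]
  constructor
  · rintro ⟨hinj, h⟩
    refine ⟨fun i hi => by simpa using hinj hi, fun i j l hp hi hj => ?_⟩
    have := h s(.inl 0, .inr i) (by simp) s(.inl 0, .inr j) (by simp) l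
      (by simp [hp, hi]) (by simp [hp, hj])
    simpa using this
  · rintro ⟨hne, h⟩
    refine ⟨?_, fun e₁ he₁ e₂ he₂ l h₁ h₂ => ?_⟩
    · rintro (a | a) (b | b) hab
      · rw [Subsingleton.elim a b]
      · rw [Subsingleton.elim a 0] at hab
        exact (hne b hab.symm).elim
      · rw [Subsingleton.elim b 0] at hab
        exact (hne a hab).elim
      · have hl := Configuration.HasLines.mkLine_ax (L := L) (hne a)
        rw [h a b _ hl.2 hl.1 (hab ▸ hl.1)]
    · obtain ⟨i, rfl⟩ := edge he₁
      obtain ⟨j, rfl⟩ := edge he₂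
      rw [h i j l (h₁ _ (by simp)) (h₁ _ (by simp)) (h₂ _ (by simp))]

/-- A star embedding consists of a center, an injective choice of lines through it, and a point
other than the center on each of these lines. -/
theorem card_star_embeddings_eq_card_sigma (P L : Type*) [Membership P L]
    [Configuration.HasLines P L] (n : ℕ) :
    Nat.card {φ : Fin 1 ⊕ Fin n → P //
        IsGraphEmbedding (completeBipartiteGraph (Fin 1) (Fin n)) P L φ} =
      Nat.card (Σ p : P, Σ e : Fin n ↪ {l : L // p ∈ l},
        ∀ i, {x : P // x ∈ (e i).1 ∧ x ≠ p}) := by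
  symm
  let f : (Σ p : P, Σ e : Fin n ↪ {l : L // p ∈ l}, ∀ i, {x : P // x ∈ (e i).1 ∧ x ≠ p}) →
      {φ : Fin 1 ⊕ Fin n → P //
        IsGraphEmbedding (completeBipartiteGraph (Fin 1) (Fin n)) P L φ} :=
    fun s => ⟨Sum.elim (fun _ => s.1) (fun i => (s.2.2 i).1), by
      obtain ⟨p, e, x⟩ := s
      rw [isGraphEmbedding_star_iff]
      refine ⟨fun i => (x i).2.2, fun i j l hp hi hj => e.injective (Subtype.ext ?_)⟩
      have key (k : Fin n) (hk : (x k).1 ∈ l) : (e k).1 = l :=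
        (Configuration.Nondegenerate.eq_or_eq (x k).2.1 (e k).2 hk hp).resolve_left (x k).2.2
      exact (key i hi).trans (key j hj).symm⟩
  refine Nat.card_eq_of_bijective f ⟨?_, ?_⟩
  · rintro ⟨p, e, x⟩ ⟨p', e', x'⟩ h
    have h := congrArg Subtype.val h
    obtain rfl : p = p' := congrFun h (.inl 0)
    have hx (i : Fin n) : (x i).1 = (x' i).1 := congrFun h (.inr i)
    obtain rfl : e = e' := by
      ext i
      exact (Configuration.Nondegenerate.eq_or_eq (x i).2.1 (e i).2
        (hx i ▸ (x' i).2.1) (e' i).2).resolve_left (x i).2.2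
    obtain rfl : x = x' := funext fun i => Subtype.ext (hx i)
    rfl
  · rintro ⟨φ, hφ⟩
    obtain ⟨hne, h⟩ := isGraphEmbedding_star_iff.1 hφ
    have hl (i : Fin n) := Configuration.HasLines.mkLine_ax (L := L) (hne i)
    refine ⟨⟨φ (.inl 0), ⟨fun i => ⟨Configuration.HasLines.mkLine (hne i), (hl i).2⟩,
      fun i j hij => ?_⟩, fun i => ⟨φ (.inr i), (hl i).1, hne i⟩⟩, ?_⟩
    · have hij := congrArg Subtype.val hij
      dsimp only at hij
      exact h i j _ (hl i).2 (hl i).1 (hij ▸ (hl j).1)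
    · refine Subtype.ext (funext ?_)
      rintro (a | a)
      · rw [Subsingleton.elim a 0]
        rfl
      · rfl

/-- The number of embeddings of the star `K_{1,n}` (with `1 ≤ n ≤ q+1`) into a finite
projective plane of order `q` is `(q² + q + 1) · C(q+1, n) · qⁿ · n!`. -/
theorem count_star_embeddings {P L : Type*} [Fintype P] [Fintype L]
    [Membership P L] [Configuration.ProjectivePlane P L] (n q : ℕ)
    (hn : 1 ≤ n) (hnq : n ≤ q + 1)
    (hq : Configuration.ProjectivePlane.order P L = q) :
    Set.ncard {φ : Fin 1 ⊕ Fin n → P |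
        IsGraphEmbedding (completeBipartiteGraph (Fin 1) (Fin n)) P L φ} =
      (q ^ 2 + q + 1) * (q + 1).choose n * q ^ n * n.factorial := by
  classical
  have hlines (p : P) : Nat.card (Fin n ↪ {l : L // p ∈ l}) = (q + 1).descFactorial n := by
    have h : Nat.card {l : L // p ∈ l} = q + 1 :=
      hq ▸ Configuration.ProjectivePlane.lineCount_eq L p
    rw [Nat.card_eq_fintype_card, Fintype.card_embedding_eq, Fintype.card_fin,
      ← Nat.card_eq_fintype_card, h]
  have hleaves (p : P) (e : Fin n ↪ {l : L // p ∈ l}) :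
      Nat.card (∀ i, {x : P // x ∈ (e i).1 ∧ x ≠ p}) = q ^ n := by
    rw [Nat.card_pi, Finset.prod_congr rfl fun i _ => card_mem_line_ne (e i).2, hq,
      Finset.prod_const, Finset.card_univ, Fintype.card_fin]
  rw [← Nat.card_coe_set_eq]
  refine (card_star_embeddings_eq_card_sigma P L n).trans ?_
  simp_rw [Nat.card_sigma, hleaves, Finset.sum_const, Finset.card_univ, ← Nat.card_eq_fintype_card,
    hlines, Finset.sum_const, Finset.card_univ, Configuration.ProjectivePlane.card_points P L, hq,
    Nat.descFactorial_eq_factorial_mul_choose, smul_eq_mul]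
  ring
end

section
/- Let π be a finite projective plane of order q and let n satisfy 2 ≤ n ≤ q. Let φ be an embedding of the complete bipartite graph K_{n,q} into π, with classes U of size n and V of size q. Then the image φ(U) is contained in a single line of π, namely, there exists a line m of π incident with φ(u) for every u ∈ U. -/
open Configuration in
/-- If `q` points are joined to `p` by distinct lines in a plane of order `q`, then at most one
line through `p` avoids all of these points. -/
theorem Configuration.ProjectivePlane.eq_of_forall_notMem {P L : Type*} [Finite P] [Finite L]
    [Membership P L] [ProjectivePlane P L] {p : P} {f : Fin (ProjectivePlane.order P L) → P}
    {g : Fin (ProjectivePlane.order P L) → L} (hg : Function.Injective g)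
    (hp : ∀ i, p ∈ g i) (hf : ∀ i, f i ∈ g i) {m m' : L} (hm : p ∈ m) (hm' : p ∈ m')
    (hfm : ∀ i, f i ∉ m) (hfm' : ∀ i, f i ∉ m') : m = m' := by
  classical
  have := Fintype.ofFinite L
  by_contra hne
  have hsub : insert m (insert m' (Finset.univ.image g)) ⊆
      Finset.univ.filter (fun l : L => p ∈ l) := by
    intro l
    simp only [Finset.mem_insert, Finset.mem_image, Finset.mem_univ, true_and, Finset.mem_filter]
    rintro (rfl | rfl | ⟨i, rfl⟩)
    exacts [hm, hm', hp i]
  have hcard := Finset.card_le_card hsub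
  have hm'g : m' ∉ Finset.univ.image g := by
    simp only [Finset.mem_image, Finset.mem_univ, true_and, not_exists]
    rintro i rfl
    exact hfm' i (hf i)
  have hmg : m ∉ insert m' (Finset.univ.image g) := by
    simp only [Finset.mem_insert, Finset.mem_image, Finset.mem_univ, true_and, not_or, not_exists]
    refine ⟨hne, ?_⟩
    rintro i rfl
    exact hfm i (hf i)
  have hlines : (Finset.univ.filter (fun l : L => p ∈ l)).card = ProjectivePlane.order P L + 1 := by
    rw [← ProjectivePlane.lineCount_eq (L := L) p, lineCount, Nat.card_eq_fintype_card,
      Fintype.card_subtype]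
  rw [Finset.card_insert_of_notMem hmg, Finset.card_insert_of_notMem hm'g,
    Finset.card_image_of_injective _ hg, Finset.card_univ, Fintype.card_fin, hlines] at hcard
  omega

/-- In an embedding of a complete bipartite graph, two edges lying on the same line agree. -/
theorem IsGraphEmbedding.eq_and_eq_of_mem {A B P L : Type*} [Membership P L] {φ : A ⊕ B → P}
    (hφ : IsGraphEmbedding (completeBipartiteGraph A B) P L φ) {a a' : A} {b b' : B} {l : L}
    (ha : φ (Sum.inl a) ∈ l) (hb : φ (Sum.inr b) ∈ l)
    (ha' : φ (Sum.inl a') ∈ l) (hb' : φ (Sum.inr b') ∈ l) : a = a' ∧ b = b' := by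
  have h := hφ.2 s(Sum.inl a, Sum.inr b) (by simp) s(Sum.inl a', Sum.inr b') (by simp) l
    (by simp [ha, hb]) (by simp [ha', hb'])
  simpa using h

/-- If `2 ≤ n ≤ q` and `φ` is an embedding of the complete bipartite graph `K_{n,q}` into a
finite projective plane of order `q`, then the image of the class `U` of size `n` is
contained in a single line. -/
theorem embedding_small_class_collinear {P L : Type*} [Fintype P] [Fintype L]
    [Membership P L] [Configuration.ProjectivePlane P L] (n q : ℕ)
    (hn : 2 ≤ n) (hnq : n ≤ q)
    (hq : Configuration.ProjectivePlane.order P L = q)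
    (φ : Fin n ⊕ Fin q → P)
    (hφ : IsGraphEmbedding (completeBipartiteGraph (Fin n) (Fin q)) P L φ) :
    ∃ m : L, ∀ u : Fin n, φ (Sum.inl u) ∈ m := by
  subst hq
  have hne : ∀ v, φ (Sum.inl ⟨0, by omega⟩) ≠ φ (Sum.inr v) := fun v h => by
    simpa using hφ.1 h
  have hjoin : ∀ u, u ≠ ⟨0, by omega⟩ → φ (Sum.inl ⟨0, by omega⟩) ≠ φ (Sum.inl u) :=
    fun u hu h => hu (by simpa using (hφ.1 h).symm)
  have h01 := hjoin ⟨1, by omega⟩ (by simp)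
  have hm := Configuration.HasLines.mkLine_ax (L := L) h01
  refine ⟨Configuration.HasLines.mkLine h01, fun u => ?_⟩
  by_cases hu : u = ⟨0, by omega⟩
  · exact hu ▸ hm.1
  have hm' := Configuration.HasLines.mkLine_ax (L := L) (hjoin u hu)
  have hax : ∀ v, ∃ l : L, φ (Sum.inl ⟨0, by omega⟩) ∈ l ∧ φ (Sum.inr v) ∈ l :=
    fun v => ⟨_, Configuration.HasLines.mkLine_ax (hne v)⟩
  choose g hg₀ hg using hax
  have heq := Configuration.ProjectivePlane.eq_of_forall_notMem
    (f := fun v => φ (Sum.inr v)) (g := g)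
    (fun v w hvw => (hφ.eq_and_eq_of_mem (hg₀ v) (hg v) (hg₀ v) (hvw ▸ hg w)).2)
    hg₀ hg hm.1 hm'.1
    (fun v hv => by simpa using (hφ.eq_and_eq_of_mem hm.1 hv hm.2 hv).1)
    (fun v hv => hu (hφ.eq_and_eq_of_mem hm'.2 hv hm'.1 hv).1)
  exact heq ▸ hm'.2
end

section
/- Let π be a finite projective plane of order q with q ≥ 3, and let φ be an embedding of the complete bipartite graph K_{q-1,q} into π, with classes U of size q-1 and V of size q. Then there exist lines ℓ and m of π such that φ(U) is contained in the point set of ℓ and φ(V) is contained in the point set of m; in particular the image of each class is collinear. -/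
open Configuration Configuration.ProjectivePlane Finset

section

variable {P L : Type*} [Membership P L]

/-- In an embedding of a complete bipartite graph, a line through a vertex of the second class
meets the image of the first class in at most one vertex. -/
theorem IsGraphEmbedding.inl_eq_of_mem {A B : Type*} {φ : A ⊕ B → P}
    (hφ : IsGraphEmbedding (completeBipartiteGraph A B) P L φ) {a a' : A} {b : B} {l : L}
    (ha : φ (Sum.inl a) ∈ l) (ha' : φ (Sum.inl a') ∈ l) (hb : φ (Sum.inr b) ∈ l) : a = a' := by
  have h := hφ.2 s(Sum.inl a, Sum.inr b) (by simp) s(Sum.inl a', Sum.inr b) (by simp) l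
    (by simp [ha, hb]) (by simp [ha', hb])
  simpa using h

/-- In an embedding of a complete bipartite graph, a line through a vertex of the first class
meets the image of the second class in at most one vertex. -/
theorem IsGraphEmbedding.inr_eq_of_mem {A B : Type*} {φ : A ⊕ B → P}
    (hφ : IsGraphEmbedding (completeBipartiteGraph A B) P L φ) {a : A} {b b' : B} {l : L}
    (ha : φ (Sum.inl a) ∈ l) (hb : φ (Sum.inr b) ∈ l) (hb' : φ (Sum.inr b') ∈ l) : b = b' := by
  have h := hφ.2 s(Sum.inl a, Sum.inr b) (by simp) s(Sum.inl a, Sum.inr b') (by simp) l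
    (by simp [ha, hb]) (by simp [ha, hb'])
  simpa using h

/-- Any two distinct points have a common line. -/
theorem Configuration.HasLines.exists_line_through [HasLines P L] {p₁ p₂ : P} (h : p₁ ≠ p₂) :
    ∃ l : L, p₁ ∈ l ∧ p₂ ∈ l :=
  ⟨HasLines.mkLine h, HasLines.mkLine_ax h⟩

/-- Any two lines through a point that avoid an injective family of `order P L` lines through that
point coincide. -/
theorem Configuration.ProjectivePlane.eq_of_mem_of_notMem_range [Finite P] [Finite L]
    [ProjectivePlane P L] {p : P} {f : Fin (order P L) → L} (hf : Function.Injective f)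
    (hfp : ∀ i, p ∈ f i) {l m : L} (hl : p ∈ l) (hm : p ∈ m) (hfl : ∀ i, f i ≠ l)
    (hfm : ∀ i, f i ≠ m) : l = m := by
  classical
  cases nonempty_fintype L
  have hS : #{k : L | p ∈ k} = order P L + 1 := by
    rw [← lineCount_eq L p, lineCount, Nat.card_eq_fintype_card, Fintype.card_subtype]
  have hT : #(univ.image f) = order P L := by
    rw [card_image_of_injective _ hf, card_univ, Fintype.card_fin]
  have hTS : univ.image f ⊆ ({k : L | p ∈ k} : Finset L) := by
    intro k hk
    obtain ⟨i, -, rfl⟩ := mem_image.1 hk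
    simpa using hfp i
  have hc := card_sdiff_of_subset hTS
  rw [hS, hT, Nat.add_sub_cancel_left] at hc
  exact card_le_one.1 hc.le l (by simp [hl, hfl]) m (by simp [hm, hfm])

/-- Given an injective family of `order P L - 1` points of a line, every point of the line outside
the family is one of two fixed points of the line. -/
theorem Configuration.ProjectivePlane.exists_two_points [Finite P] [Finite L]
    [ProjectivePlane P L] {l : L} {f : Fin (order P L - 1) → P} (hf : Function.Injective f)
    (hfl : ∀ i, f i ∈ l) :
    ∃ x ∈ l, ∃ y ∈ l, ∀ p ∈ l, (∀ i, f i ≠ p) → p = x ∨ p = y := by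
  classical
  cases nonempty_fintype P
  have hS : #{p : P | p ∈ l} = order P L + 1 := by
    rw [← pointCount_eq P l, pointCount, Nat.card_eq_fintype_card, Fintype.card_subtype]
  have hT : #(univ.image f) = order P L - 1 := by
    rw [card_image_of_injective _ hf, card_univ, Fintype.card_fin]
  have hTS : univ.image f ⊆ ({p : P | p ∈ l} : Finset P) := by
    intro k hk
    obtain ⟨i, -, rfl⟩ := mem_image.1 hk
    simpa using hfl i
  have hc := card_sdiff_of_subset hTS
  have h1 := one_lt_order P L
  rw [hS, hT, show order P L + 1 - (order P L - 1) = 2 by omega] at hc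
  obtain ⟨x, y, -, hxy⟩ := card_eq_two.1 hc
  have key (p : P) : p ∈ l ∧ (∀ i, f i ≠ p) ↔ p = x ∨ p = y := by
    simpa using Finset.ext_iff.1 hxy p
  exact ⟨x, ((key x).2 (.inl rfl)).1, y, ((key y).2 (.inr rfl)).1,
    fun p hp hpf => (key p).1 ⟨hp, hpf⟩⟩

/-- If every line joining two points of a family passes through one of two fixed points outside the
family, then the family is collinear. -/
theorem Configuration.HasLines.exists_line_of_two_points [HasLines P L] {B : Type*} [Nonempty B]
    {ψ : B → P} {x y : P} (hx : ∀ b, ψ b ≠ x) (hy : ∀ b, ψ b ≠ y)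
    (h : ∀ b b', b ≠ b' → ∃ m : L, ψ b ∈ m ∧ ψ b' ∈ m ∧ (x ∈ m ∨ y ∈ m)) :
    ∃ m : L, ∀ b, ψ b ∈ m := by
  obtain ⟨b₀⟩ := ‹Nonempty B›
  obtain ⟨k, hk, hxk⟩ := exists_line_through (L := L) (hx b₀)
  obtain ⟨m, hm, hym⟩ := exists_line_through (L := L) (hy b₀)
  have eq_of_x {b : B} {n n' : L} (h₁ : ψ b ∈ n) (h₂ : x ∈ n) (h₃ : ψ b ∈ n') (h₄ : x ∈ n') :
      n = n' := (Nondegenerate.eq_or_eq h₁ h₂ h₃ h₄).resolve_left (hx b)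
  have eq_of_y {b : B} {n n' : L} (h₁ : ψ b ∈ n) (h₂ : y ∈ n) (h₃ : ψ b ∈ n') (h₄ : y ∈ n') :
      n = n' := (Nondegenerate.eq_or_eq h₁ h₂ h₃ h₄).resolve_left (hy b)
  have mem_or (b : B) : ψ b ∈ k ∨ ψ b ∈ m := by
    by_cases hb : b₀ = b
    · exact .inl (hb ▸ hk)
    · obtain ⟨n, h₀, h₁, hn | hn⟩ := h b₀ b hb
      · exact .inl (eq_of_x h₀ hn hk hxk ▸ h₁)
      · exact .inr (eq_of_y h₀ hn hm hym ▸ h₁)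
  by_cases hall : ∀ b, ψ b ∈ k
  · exact ⟨k, hall⟩
  · push Not at hall
    obtain ⟨b₁, hb₁⟩ := hall
    have hb₁m := (mem_or b₁).resolve_left hb₁
    refine ⟨m, fun b => (mem_or b).elim (fun hbk => ?_) id⟩
    obtain ⟨n, h₁, h₂, hn | hn⟩ := h b₁ b (fun e => hb₁ (e ▸ hbk))
    · exact absurd (eq_of_x h₂ hn hbk hxk ▸ h₁) hb₁
    · exact eq_of_y h₁ hn hb₁m hym ▸ h₂

end

/-- If `q ≥ 3` and `φ` is an embedding of `K_{q-1,q}` into a finite projective plane of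
order `q`, then the image of each of the two classes is contained in a single line. -/
theorem embedding_Kqm1q_classes_collinear {P L : Type*} [Fintype P] [Fintype L]
    [Membership P L] [Configuration.ProjectivePlane P L] (q : ℕ) (hq3 : 3 ≤ q)
    (hq : Configuration.ProjectivePlane.order P L = q)
    (φ : Fin (q - 1) ⊕ Fin q → P)
    (hφ : IsGraphEmbedding (completeBipartiteGraph (Fin (q - 1)) (Fin q)) P L φ) :
    ∃ ℓ m : L, (∀ u : Fin (q - 1), φ (Sum.inl u) ∈ ℓ) ∧ (∀ v : Fin q, φ (Sum.inr v) ∈ m) := by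
  subst hq
  have hinj := hφ.1
  let u₀ : Fin (order P L - 1) := ⟨0, by omega⟩
  let u₁ : Fin (order P L - 1) := ⟨1, by omega⟩
  have hu : u₀ ≠ u₁ := by simp [u₀, u₁]
  obtain ⟨ℓ, hℓ₀, hℓ₁⟩ := HasLines.exists_line_through (L := L) (hinj.ne (Sum.inl_injective.ne hu))
  have hVℓ (v : Fin (order P L)) : φ (Sum.inr v) ∉ ℓ := fun hv => hu (hφ.inl_eq_of_mem hℓ₀ hℓ₁ hv)
  choose f hf₀ hfv using fun v : Fin (order P L) =>
    HasLines.exists_line_through (L := L) (hinj.ne (Sum.inl_ne_inr (a := u₀) (b := v)))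
  have hf : Function.Injective f := fun v w h =>
    hφ.inr_eq_of_mem (hf₀ v) (hfv v) (h ▸ hfv w)
  have hUℓ (u : Fin (order P L - 1)) : φ (Sum.inl u) ∈ ℓ := by
    by_cases h : u₀ = u
    · exact h ▸ hℓ₀
    obtain ⟨k, hk₀, hk⟩ := HasLines.exists_line_through (L := L) (hinj.ne (Sum.inl_injective.ne h))
    have hkℓ : k = ℓ := eq_of_mem_of_notMem_range hf hf₀ hk₀ hℓ₀
      (fun v e => h (hφ.inl_eq_of_mem hk₀ hk (e ▸ hfv v))) (fun v e => hVℓ v (e ▸ hfv v))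
    exact hkℓ ▸ hk
  obtain ⟨x, hx, y, hy, hxy⟩ := exists_two_points (hinj.comp Sum.inl_injective) hUℓ
  have : Nonempty (Fin (order P L)) := ⟨⟨0, by omega⟩⟩
  obtain ⟨m, hm⟩ := HasLines.exists_line_of_two_points (L := L) (ψ := fun v => φ (Sum.inr v))
    (fun v e => hVℓ v (e ▸ hx)) (fun v e => hVℓ v (e ▸ hy)) fun v w hvw => by
      obtain ⟨n, hv, hw⟩ :=
        HasLines.exists_line_through (L := L) (hinj.ne (Sum.inr_injective.ne hvw))
      have hnℓ : n ≠ ℓ := fun e => hVℓ v (e ▸ hv)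
      obtain ⟨hpn, hpℓ⟩ := HasPoints.mkPoint_ax (P := P) hnℓ
      have hUn (u : Fin (order P L - 1)) : φ (Sum.inl u) ∉ n := fun hun =>
        hvw (hφ.inr_eq_of_mem hun hv hw)
      refine ⟨n, hv, hw, ?_⟩
      obtain e | e := hxy _ hpℓ fun u (e : φ (Sum.inl u) = _) => hUn u (e ▸ hpn)
      · exact .inl (e ▸ hpn)
      · exact .inr (e ▸ hpn)
  exact ⟨ℓ, m, hUℓ, hm⟩
end

section
/- Let π be a finite projective plane and let φ be an embedding of the complete bipartite graph K_{m,n} into π. Then no complement line of the embedding equals a line of the form φ̄(e) for an edge e of K_{m,n}; that is, if u and w are distinct non-adjacent vertices of K_{m,n} and a, b are adjacent vertices, then the unique line of π through φ(u) and φ(w) is different from the unique line of π through φ(a) and φ(b). -/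
/-- A line containing the images of two vertices `u` and `w` with a common neighbour `x` under a
graph embedding, and also the image of `x`, forces `u = w`. -/
theorem IsGraphEmbedding.eq_of_common_neighbor {V P L : Type*} [Membership P L]
    {G : SimpleGraph V} {φ : V → P} (hφ : IsGraphEmbedding G P L φ) {u w x : V}
    (hux : G.Adj u x) (hwx : G.Adj w x) {ℓ : L} (hu : φ u ∈ ℓ) (hw : φ w ∈ ℓ) (hx : φ x ∈ ℓ) :
    u = w := by
  have h : s(u, x) = s(w, x) := hφ.2 _ hux _ hwx ℓ (by simp [hu, hx]) (by simp [hw, hx])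
  exact Sym2.congr_left.mp h

/-- In a complete bipartite graph, two non-adjacent vertices have one of the endpoints of any given
edge as a common neighbour. -/
theorem adj_or_adj_of_not_adj_completeBipartiteGraph {V W : Type*} {u w a b : V ⊕ W}
    (huw : ¬ (completeBipartiteGraph V W).Adj u w) (hab : (completeBipartiteGraph V W).Adj a b) :
    (completeBipartiteGraph V W).Adj u a ∧ (completeBipartiteGraph V W).Adj w a ∨
      (completeBipartiteGraph V W).Adj u b ∧ (completeBipartiteGraph V W).Adj w b := by
  cases u <;> cases w <;> cases a <;> cases b <;> simp_all

/-- For an embedding `φ` of the complete bipartite graph `K_{m,n}` into a projective plane,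
every complement line (the unique line through the images of two distinct non-adjacent
vertices) is different from every embedded edge (the unique line through the images of two
adjacent vertices). -/
theorem complement_line_ne_edge_line {P L : Type*} [Fintype P] [Fintype L]
    [Membership P L] [Configuration.ProjectivePlane P L] (m n : ℕ)
    (φ : Fin m ⊕ Fin n → P)
    (hφ : IsGraphEmbedding (completeBipartiteGraph (Fin m) (Fin n)) P L φ)
    (u w a b : Fin m ⊕ Fin n) (huw : u ≠ w)
    (hnadj : ¬ (completeBipartiteGraph (Fin m) (Fin n)).Adj u w)
    (hadj : (completeBipartiteGraph (Fin m) (Fin n)).Adj a b) :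
    Configuration.HasLines.mkLine (P := P) (L := L) (hφ.1.ne huw) ≠
      Configuration.HasLines.mkLine (P := P) (L := L) (hφ.1.ne hadj.ne) := by
  intro h
  obtain ⟨hu, hw⟩ := Configuration.HasLines.mkLine_ax (P := P) (L := L) (hφ.1.ne huw)
  obtain ⟨ha, hb⟩ := Configuration.HasLines.mkLine_ax (P := P) (L := L) (hφ.1.ne hadj.ne)
  rw [← h] at ha hb
  rcases adj_or_adj_of_not_adj_completeBipartiteGraph hnadj hadj with ⟨hua, hwa⟩ | ⟨hub, hwb⟩
  · exact huw (hφ.eq_of_common_neighbor hua hwa hu hw ha)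
  · exact huw (hφ.eq_of_common_neighbor hub hwb hu hw hb)
end

section
/- Let π be a finite projective plane of order q, let n be a natural number with q > n², and suppose 2 ≤ q - n. Let φ be an embedding of the complete bipartite graph K_{q-n,q} into π, with classes U of size q-n and V of size q. Then there exist lines ℓ and m of π such that φ(U) is contained in the point set of ℓ and φ(V) is contained in the point set of m. -/
open Configuration in
/-- A family of points avoiding a line `ℓ` and determining at most `n + 1` directions on `ℓ` is
collinear as soon as it has more than `n ^ 2` members. -/
theorem exists_line_of_few_directions {P L ι : Type*} [Membership P L] [Nondegenerate P L]
    [Fintype ι] [Nontrivial ι] {n : ℕ} {b : ι → P} (hb : Function.Injective b) {ℓ : L}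
    (hbℓ : ∀ i, b i ∉ ℓ) {W : Finset P} (hWℓ : ∀ w ∈ W, w ∈ ℓ) (hWcard : W.card ≤ n + 1)
    (hdir : ∀ i j, i ≠ j → ∃ w ∈ W, ∃ l : L, b i ∈ l ∧ b j ∈ l ∧ w ∈ l)
    (hcard : n ^ 2 < Fintype.card ι) : ∃ m : L, ∀ i, b i ∈ m := by
  classical
  obtain ⟨i₀, i₁, h01⟩ := exists_pair_ne ι
  have : Nonempty P := ⟨b i₀⟩
  choose! d hdW hd using hdir
  by_contra! hnc
  have line_eq : ∀ {i : ι} {w : P} {l l' : L}, w ∈ W → b i ∈ l → w ∈ l → b i ∈ l' → w ∈ l' →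
      l = l' := fun hw h1 h2 h3 h4 ↦
    (Nondegenerate.eq_or_eq h1 h2 h3 h4).resolve_left fun h ↦ hbℓ _ (h ▸ hWℓ _ hw)
  have line_card : ∀ i j, i ≠ j → ∀ l : L, b i ∈ l → b j ∈ l →
      (Finset.univ.filter fun k ↦ b k ∈ l).card ≤ n := by
    intro i j hij l hi hj
    obtain ⟨v, hv⟩ := hnc l
    have hdl : d i j ∈ l := by
      obtain ⟨l', h1, h2, h3⟩ := hd i j hij
      rwa [(Nondegenerate.eq_or_eq hi hj h1 h2).resolve_left (hb.ne hij)]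
    have hne : ∀ k, b k ∈ l → v ≠ k := fun k hk h ↦ hv (h ▸ hk)
    have h : (Finset.univ.filter fun k ↦ b k ∈ l).card ≤ (W.erase (d i j)).card := by
      refine Finset.card_le_card_of_injOn (d v) ?_ ?_
      · intro k hk
        have hk : b k ∈ l := by simpa using hk
        refine Finset.mem_coe.2 (Finset.mem_erase.2 ⟨fun h ↦ ?_, hdW v k (hne k hk)⟩)
        obtain ⟨l', h1, h2, h3⟩ := hd v k (hne k hk)
        rw [h] at h3
        exact hv (line_eq (hdW i j hij) hk hdl h2 h3 ▸ h1)
      · intro k hk k' hk' h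
        have hk : b k ∈ l := by simpa using hk
        have hk' : b k' ∈ l := by simpa using hk'
        obtain ⟨l₁, h1, h2, h3⟩ := hd v k (hne k hk)
        obtain ⟨l₂, g1, g2, g3⟩ := hd v k' (hne k' hk')
        rw [← h] at g3
        obtain rfl := line_eq (hdW v k (hne k hk)) h1 h3 g1 g3
        refine hb ((Nondegenerate.eq_or_eq h2 g2 hk hk').resolve_right fun e ↦ hv (e ▸ h1))
    rw [Finset.card_erase_of_mem (hdW i j hij)] at h
    omega
  have hcount := Finset.card_le_mul_card_image (f := d i₀) (Finset.univ.erase i₀) (n - 1) (by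
    intro w hw
    obtain ⟨j, hj, rfl⟩ := Finset.mem_image.1 hw
    have hj : i₀ ≠ j := (Finset.ne_of_mem_erase hj).symm
    obtain ⟨l, h1, h2, h3⟩ := hd i₀ j hj
    refine Nat.le_sub_one_of_lt
      ((Finset.card_lt_card ?_).trans_le (line_card i₀ j hj l h1 h2))
    refine (Finset.ssubset_iff_of_subset fun k hk ↦ ?_).2 ⟨i₀, by simpa using h1, by simp⟩
    obtain ⟨hk, hkd⟩ : k ≠ i₀ ∧ d i₀ k = d i₀ j := by simpa using hk
    obtain ⟨l', g1, g2, g3⟩ := hd i₀ k hk.symm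
    rw [hkd] at g3
    rw [line_eq (hdW i₀ j hj) h1 h3 g1 g3]
    simpa using g2)
  have himage : ((Finset.univ.erase i₀).image (d i₀)).card ≤ n + 1 :=
    (Finset.card_le_card (Finset.image_subset_iff.2 fun j hj ↦
      hdW i₀ j (Finset.ne_of_mem_erase hj).symm)).trans hWcard
  have hle := hcount.trans (Nat.mul_le_mul_left (n - 1) himage)
  rw [Finset.card_erase_of_mem (Finset.mem_univ _), Finset.card_univ] at hle
  have hlt := Fintype.one_lt_card (α := ι)
  obtain _ | n := n
  · omega
  · simp only [Nat.add_sub_cancel] at hle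
    have : Fintype.card ι ≤ n * (n + 1 + 1) + 1 := by omega
    nlinarith

open Configuration in
/-- If `q` points lie on distinct lines through a point `p` of a projective plane of order `q`,
then at most one line through `p` misses all of them. -/
theorem eq_of_line_missing {P L ι : Type*} [Finite P] [Finite L] [Membership P L]
    [ProjectivePlane P L] [Fintype ι] (hι : Fintype.card ι = ProjectivePlane.order P L)
    {p : P} {b : ι → P} (hb : ∀ i j, ∀ l : L, p ∈ l → b i ∈ l → b j ∈ l → i = j)
    (hpb : ∀ i, p ≠ b i) {l l' : L} (hl : p ∈ l) (hl' : p ∈ l') (hbl : ∀ i, b i ∉ l)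
    (hbl' : ∀ i, b i ∉ l') : l = l' := by
  classical
  by_contra hne
  choose g hg using fun i ↦ (⟨_, HasLines.mkLine_ax (hpb i)⟩ : ∃ m : L, p ∈ m ∧ b i ∈ m)
  let f : Option (Option ι) → {m : L // p ∈ m}
    | none => ⟨l, hl⟩
    | some none => ⟨l', hl'⟩
    | some (some i) => ⟨g i, (hg i).1⟩
  have hf : Function.Injective f := by
    rintro (_ | _ | i) (_ | _ | j) h <;> simp only [f, Subtype.mk.injEq] at h
    · rfl
    · exact (hne h).elim
    · exact (hbl j (h ▸ (hg j).2)).elim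
    · exact (hne h.symm).elim
    · rfl
    · exact (hbl' j (h ▸ (hg j).2)).elim
    · exact (hbl i (h ▸ (hg i).2)).elim
    · exact (hbl' i (h ▸ (hg i).2)).elim
    · rw [hb i j (g i) (hg i).1 (hg i).2 (h ▸ (hg j).2)]
  have hcard := Nat.card_le_card_of_injective f hf
  have hp := ProjectivePlane.lineCount_eq L p
  rw [lineCount] at hp
  rw [hp, Nat.card_eq_fintype_card, Fintype.card_option, Fintype.card_option, hι] at hcard
  omega


/-- If `q > n²`, `2 ≤ q - n`, and `φ` is an embedding of `K_{q-n,q}` into a finite projective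
plane of order `q`, then the image of each of the two classes is contained in a single
line. -/
theorem embedding_Kqmnq_classes_collinear {P L : Type*} [Fintype P] [Fintype L]
    [Membership P L] [Configuration.ProjectivePlane P L] (n q : ℕ)
    (hqn : n ^ 2 < q) (hn2 : 2 ≤ q - n)
    (hq : Configuration.ProjectivePlane.order P L = q)
    (φ : Fin (q - n) ⊕ Fin q → P)
    (hφ : IsGraphEmbedding (completeBipartiteGraph (Fin (q - n)) (Fin q)) P L φ) :
    ∃ ℓ m : L, (∀ u : Fin (q - n), φ (Sum.inl u) ∈ ℓ) ∧ (∀ v : Fin q, φ (Sum.inr v) ∈ m) := by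
  classical
  obtain ⟨hinj, hedge⟩ := hφ
  have key : ∀ u u' v v', ∀ l : L, φ (.inl u) ∈ l → φ (.inr v) ∈ l → φ (.inl u') ∈ l →
      φ (.inr v') ∈ l → u = u' ∧ v = v' := by
    intro u u' v v' l h1 h2 h3 h4
    have h := hedge s(.inl u, .inr v) (by simp) s(.inl u', .inr v') (by simp) l
      (by simp [h1, h2]) (by simp [h3, h4])
    simpa using h
  let u₀ : Fin (q - n) := ⟨0, by omega⟩
  let u₁ : Fin (q - n) := ⟨1, by omega⟩
  have h01 : u₀ ≠ u₁ := by simp [u₀, u₁]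
  have hmiss : ∀ u u', u ≠ u' → ∀ l : L, φ (.inl u) ∈ l → φ (.inl u') ∈ l →
      ∀ v, φ (.inr v) ∉ l :=
    fun u u' hu l h1 h2 v hv ↦ hu (key u u' v v l h1 hv h2 hv).1
  obtain ⟨ℓ, hℓ₀, hℓ₁⟩ : ∃ ℓ : L, φ (.inl u₀) ∈ ℓ ∧ φ (.inl u₁) ∈ ℓ :=
    ⟨_, Configuration.HasLines.mkLine_ax (hinj.ne (by simpa using h01))⟩
  have hVℓ := hmiss u₀ u₁ h01 ℓ hℓ₀ hℓ₁
  have hUℓ : ∀ u, φ (.inl u) ∈ ℓ := by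
    intro u
    by_cases hu : u₀ = u
    · exact hu ▸ hℓ₀
    obtain ⟨l, h1, h2⟩ : ∃ l : L, φ (.inl u₀) ∈ l ∧ φ (.inl u) ∈ l :=
      ⟨_, Configuration.HasLines.mkLine_ax (hinj.ne (by simpa using hu))⟩
    rwa [eq_of_line_missing (by simp [hq])
      (fun v v' m hm hv hv' ↦ (key u₀ u₀ v v' m hm hv hm hv').2) (fun v ↦ hinj.ne (by simp))
      hℓ₀ h1 hVℓ (hmiss u₀ u hu l h1 h2)]
  let W : Finset P :=
    (Finset.univ.filter (· ∈ ℓ)) \ Finset.univ.image (φ ∘ Sum.inl)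
  have hWcard : W.card ≤ n + 1 := by
    have hline : (Finset.univ.filter (· ∈ ℓ)).card = q + 1 := by
      have h := Configuration.ProjectivePlane.pointCount_eq P ℓ
      rwa [Configuration.pointCount, hq, Nat.card_eq_fintype_card, Fintype.card_subtype] at h
    rw [Finset.card_sdiff_of_subset (Finset.image_subset_iff.2 fun u _ ↦ by simpa using hUℓ u),
      hline, Finset.card_image_of_injective _ (hinj.comp Sum.inl_injective), Finset.card_univ,
      Fintype.card_fin]
    omega
  have : Nontrivial (Fin q) := Fin.nontrivial_iff_two_le.2 (by omega)
  obtain ⟨m, hm⟩ := exists_line_of_few_directions (L := L) (hinj.comp Sum.inr_injective) hVℓ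
    (W := W) (fun w hw ↦ by simpa using (Finset.mem_sdiff.1 hw).1) hWcard (by
      intro v v' hv
      obtain ⟨l, h1, h2⟩ : ∃ l : L, φ (.inr v) ∈ l ∧ φ (.inr v') ∈ l :=
        ⟨_, Configuration.HasLines.mkLine_ax (hinj.ne (by simpa using hv))⟩
      have hl : l ≠ ℓ := fun h ↦ hVℓ v (h ▸ h1)
      have hx := Configuration.HasPoints.mkPoint_ax (P := P) hl
      refine ⟨Configuration.HasPoints.mkPoint hl, ?_, l, h1, h2, hx.1⟩
      refine Finset.mem_sdiff.2 ⟨by simpa using hx.2, fun h ↦ ?_⟩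
      obtain ⟨u, -, hu⟩ := Finset.mem_image.1 h
      have hul : (φ ∘ Sum.inl) u ∈ l := hu ▸ hx.1
      exact hv (key u u v v' l hul h1 hul h2).2) (by simpa using hqn)
  exact ⟨ℓ, m, hUℓ, hm⟩
end

section
/- Let π be a finite projective plane of order q and let n > 1 be a natural number with q > n² + n. Let φ be an embedding of the complete bipartite graph K_{q-n, n²+n+1} into π, and let V be the class of size n²+n+1. Then either φ(V) is contained in the point set of a single line of π, or there exists a subplane of π of order n whose point set is exactly φ(V). -/
/-- A subplane of a projective plane with points `P` and lines `L`: a set of points and a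
set of lines which, with the inherited incidence, satisfy the projective plane axioms. -/
structure Subplane (P L : Type*) [Membership P L] where
  points : Set P
  lines : Set L
  /-- Any two distinct points of the subplane lie on a unique line of the subplane. -/
  exists_unique_line : ∀ p₁ ∈ points, ∀ p₂ ∈ points, p₁ ≠ p₂ →
    ∃! ℓ, ℓ ∈ lines ∧ p₁ ∈ ℓ ∧ p₂ ∈ ℓ
  /-- Any two distinct lines of the subplane meet in a unique point of the subplane. -/
  exists_unique_point : ∀ ℓ₁ ∈ lines, ∀ ℓ₂ ∈ lines, ℓ₁ ≠ ℓ₂ →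
    ∃! p, p ∈ points ∧ p ∈ ℓ₁ ∧ p ∈ ℓ₂
  /-- There are four points of the subplane, no three of which lie on a common line of the
  subplane. -/
  nondegenerate : ∃ p₁ p₂ p₃ p₄,
    p₁ ∈ points ∧ p₂ ∈ points ∧ p₃ ∈ points ∧ p₄ ∈ points ∧
    p₁ ≠ p₂ ∧ p₁ ≠ p₃ ∧ p₁ ≠ p₄ ∧ p₂ ≠ p₃ ∧ p₂ ≠ p₄ ∧ p₃ ≠ p₄ ∧
    ∀ ℓ ∈ lines, ¬(p₁ ∈ ℓ ∧ p₂ ∈ ℓ ∧ p₃ ∈ ℓ) ∧ ¬(p₁ ∈ ℓ ∧ p₂ ∈ ℓ ∧ p₄ ∈ ℓ) ∧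
      ¬(p₁ ∈ ℓ ∧ p₃ ∈ ℓ ∧ p₄ ∈ ℓ) ∧ ¬(p₂ ∈ ℓ ∧ p₃ ∈ ℓ ∧ p₄ ∈ ℓ)

/-- A subplane has order `n` if each of its lines is incident with exactly `n + 1` of its
points. -/
def Subplane.HasOrder {P L : Type*} [Membership P L] (S : Subplane P L) (n : ℕ) : Prop :=
  ∀ ℓ ∈ S.lines, {p ∈ S.points | p ∈ ℓ}.ncard = n + 1

section

open Configuration Finset

open scoped Classical in
/-- A point of a plane of order `q` that sees the points of a set `T` along pairwise distinct
lines lies on exactly `q + 1 - #T` lines missing `T`. -/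
lemma card_lines_avoiding_add_card {P L : Type*} [Fintype P] [Fintype L] [Membership P L]
    [ProjectivePlane P L] (T : Finset P) (v : P) (hv : v ∉ T)
    (hT : ∀ u ∈ T, ∀ w ∈ T, ∀ ℓ : L, v ∈ ℓ → u ∈ ℓ → w ∈ ℓ → u = w) :
    #{ℓ : L | v ∈ ℓ ∧ ∀ u ∈ T, u ∉ ℓ} + #T = ProjectivePlane.order P L + 1 := by
  have hne : ∀ u ∈ T, v ≠ u := fun u hu h => hv (h ▸ hu)
  have hmeet : #T = #{ℓ : L | v ∈ ℓ ∧ ¬ ∀ u ∈ T, u ∉ ℓ} := by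
    refine Finset.card_bij (fun u hu => HasLines.mkLine (hne u hu)) ?_ ?_ ?_
    · intro u hu
      have h := HasLines.mkLine_ax (L := L) (hne u hu)
      simp only [Finset.mem_filter, Finset.mem_univ, true_and]
      exact ⟨h.1, fun h' => h' u hu h.2⟩
    · intro u hu w hw huw
      have h := HasLines.mkLine_ax (L := L) (hne u hu)
      have h' := HasLines.mkLine_ax (L := L) (hne w hw)
      exact hT u hu w hw _ h.1 h.2 (by rw [huw]; exact h'.2)
    · intro ℓ hℓ
      simp only [Finset.mem_filter, Finset.mem_univ, true_and, not_forall, not_not] at hℓ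
      obtain ⟨hvℓ, u, hu, huℓ⟩ := hℓ
      have h := HasLines.mkLine_ax (L := L) (hne u hu)
      exact ⟨u, hu, (Nondegenerate.eq_or_eq h.1 h.2 hvℓ huℓ).resolve_left (hne u hu)⟩
  have hcount := ProjectivePlane.lineCount_eq (P := P) L v
  rw [lineCount, Nat.card_eq_fintype_card, Fintype.card_subtype,
    ← Finset.card_filter_add_card_filter_not (fun ℓ : L => ∀ u ∈ T, u ∉ ℓ),
    Finset.filter_filter, Finset.filter_filter] at hcount
  rw [hmeet, hcount]

open scoped Classical in
/-- If `F` holds for all connecting lines of a set `S`, then at most as many points of `S` lie on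
a line `ℓ` as there are lines satisfying `F` that join a point `v ∈ S` off `ℓ` to a point of `S`
on `ℓ`. -/
lemma card_collinear_le {P L : Type*} [Fintype P] [Fintype L] [Membership P L]
    [ProjectivePlane P L] {S : Finset P} {F : L → Prop}
    (hF : ∀ v ∈ S, ∀ w ∈ S, v ≠ w → ∀ ℓ, v ∈ ℓ → w ∈ ℓ → F ℓ)
    {v : P} (hv : v ∈ S) {ℓ : L} (hvℓ : v ∉ ℓ) :
    #{w ∈ S | w ∈ ℓ} ≤ #{m : L | v ∈ m ∧ F m ∧ ∃ w ∈ S, w ∈ ℓ ∧ w ∈ m} := by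
  have hne : ∀ w ∈ ({w ∈ S | w ∈ ℓ} : Finset P), v ≠ w := by
    rintro w hw rfl
    exact hvℓ (Finset.mem_filter.1 hw).2
  refine Finset.card_le_card_of_injOn
    (fun w => if h : v ≠ w then (HasLines.mkLine h : L) else ℓ) ?_ ?_
  · intro w hw
    have h := HasLines.mkLine_ax (L := L) (hne w hw)
    have hw' := Finset.mem_filter.1 hw
    simp only [Finset.coe_filter, Finset.mem_univ, true_and, Set.mem_ofPred_eq,
      dif_pos (hne w hw)]
    exact ⟨h.1, hF v hv w hw'.1 (hne w hw) _ h.1 h.2, w, hw'.1, hw'.2, h.2⟩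
  · intro w hw x hx hwx
    simp only [dif_pos (hne w hw), dif_pos (hne x hx)] at hwx
    have h := HasLines.mkLine_ax (L := L) (hne w hw)
    have h' := HasLines.mkLine_ax (L := L) (hne x hx)
    rw [← hwx] at h'
    refine (Nondegenerate.eq_or_eq h.2 h'.2 (Finset.mem_filter.1 hw).2
      (Finset.mem_filter.1 hx).2).resolve_right fun heq => hvℓ (heq ▸ h.1)

open scoped Classical in
/-- If `n² + n + 1` points, not all collinear, are such that all connecting lines through each of
them are among `n + 1` lines, then each of these lines contains exactly `n + 1` of the points. -/
lemma card_collinear_eq {P L : Type*} [Fintype P] [Fintype L] [Membership P L]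
    [ProjectivePlane P L] {n : ℕ} {S : Finset P} (hS : #S = n ^ 2 + n + 1) {F : L → Prop}
    (hF : ∀ v ∈ S, ∀ w ∈ S, v ≠ w → ∀ ℓ, v ∈ ℓ → w ∈ ℓ → F ℓ)
    (hcard : ∀ v ∈ S, #{ℓ : L | v ∈ ℓ ∧ F ℓ} = n + 1)
    (hnot : ∀ ℓ : L, ∃ v ∈ S, v ∉ ℓ) {v : P} (hv : v ∈ S) {ℓ : L} (hvℓ : v ∈ ℓ) (hFℓ : F ℓ) :
    #{w ∈ S | w ∈ ℓ} = n + 1 := by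
  have hle : ∀ m : L, #{w ∈ S | w ∈ m} ≤ n + 1 := by
    intro m
    obtain ⟨x, hx, hxm⟩ := hnot m
    rw [← hcard x hx]
    refine (card_collinear_le hF hx hxm).trans (Finset.card_le_card ?_)
    intro k hk
    simp only [Finset.mem_filter] at hk ⊢
    exact ⟨hk.1, hk.2.1, hk.2.2.1⟩
  have herase : ∀ m ∈ ({m : L | v ∈ m ∧ F m} : Finset L),
      #{w ∈ S.erase v | w ∈ m} + 1 = #{w ∈ S | w ∈ m} := by
    intro m hm
    rw [Finset.filter_erase, Finset.card_erase_add_one]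
    simp only [Finset.mem_filter] at hm ⊢
    exact ⟨hv, hm.2.1⟩
  have hle' : ∀ m ∈ ({m : L | v ∈ m ∧ F m} : Finset L), #{w ∈ S.erase v | w ∈ m} ≤ n := by
    intro m hm
    have := herase m hm
    have := hle m
    omega
  have hcover : S.erase v = ({m : L | v ∈ m ∧ F m} : Finset L).biUnion
      fun m => {w ∈ S.erase v | w ∈ m} := by
    ext w
    simp only [Finset.mem_biUnion, Finset.mem_filter, Finset.mem_univ, true_and]
    refine ⟨fun hw => ?_, fun ⟨_, _, hw, _⟩ => hw⟩
    have hne : v ≠ w := (Finset.ne_of_mem_erase hw).symm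
    have h := HasLines.mkLine_ax (L := L) hne
    exact ⟨_, ⟨h.1, hF v hv w (Finset.mem_of_mem_erase hw) hne _ h.1 h.2⟩, hw, h.2⟩
  have hsum : #(S.erase v) ≤ ∑ m : L with v ∈ m ∧ F m, #{w ∈ S.erase v | w ∈ m} := by
    conv_lhs => rw [hcover]
    exact Finset.card_biUnion_le
  have hconst : ∑ m : L with v ∈ m ∧ F m, n = n ^ 2 + n := by
    rw [Finset.sum_const, hcard v hv, smul_eq_mul]
    ring
  have hsum_eq : ∑ m : L with v ∈ m ∧ F m, #{w ∈ S.erase v | w ∈ m} =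
      ∑ m : L with v ∈ m ∧ F m, n := by
    refine le_antisymm (Finset.sum_le_sum hle') ?_
    rw [Finset.card_erase_of_mem hv, hS] at hsum
    omega
  have hmem : ℓ ∈ ({m : L | v ∈ m ∧ F m} : Finset L) := by simp [hvℓ, hFℓ]
  have := (Finset.sum_eq_sum_iff_of_le hle').1 hsum_eq ℓ hmem
  have := herase ℓ hmem
  omega

open scoped Classical in
/-- If `n² + n + 1` points, not all collinear, are such that all connecting lines through each of
them are among `n + 1` lines, then they are the points of a subplane of order `n`. -/
lemma exists_subplane_of_card_lines {P L : Type*} [Fintype P] [Fintype L] [Membership P L]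
    [ProjectivePlane P L] {n : ℕ} (hn : 1 < n) {S : Finset P} (hS : #S = n ^ 2 + n + 1)
    {F : L → Prop} (hF : ∀ v ∈ S, ∀ w ∈ S, v ≠ w → ∀ ℓ, v ∈ ℓ → w ∈ ℓ → F ℓ)
    (hcard : ∀ v ∈ S, #{ℓ : L | v ∈ ℓ ∧ F ℓ} = n + 1)
    (hnot : ∀ ℓ : L, ∃ v ∈ S, v ∉ ℓ) :
    ∃ A : Subplane P L, A.HasOrder n ∧ A.points = S := by
  have hline : ∀ v ∈ S, ∀ ℓ : L, v ∈ ℓ → F ℓ → #{w ∈ S | w ∈ ℓ} = n + 1 :=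
    fun v hv ℓ hvℓ hFℓ => card_collinear_eq hS hF hcard hnot hv hvℓ hFℓ
  have hmeet : ∀ v ∈ S, ∀ m : L, v ∈ m → F m → ∀ x ∈ S, ∀ ℓ : L, x ∈ ℓ → F ℓ → v ∉ ℓ →
      ∃ p ∈ S, p ∈ ℓ ∧ p ∈ m := by
    intro v hv m hvm hFm x hx ℓ hxℓ hFℓ hvℓ
    have hle := card_collinear_le hF hv hvℓ
    rw [hline x hx ℓ hxℓ hFℓ, ← hcard v hv] at hle
    have heq := Finset.eq_of_subset_of_card_le (fun k hk => by
      simp only [Finset.mem_filter] at hk ⊢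
      exact ⟨hk.1, hk.2.1, hk.2.2.1⟩) hle
    have hm : m ∈ ({m : L | v ∈ m ∧ F m} : Finset L) := by simp [hvm, hFm]
    rw [← heq] at hm
    exact (Finset.mem_filter.1 hm).2.2.2
  have htwo : ∀ v ∈ S, ∀ ℓ : L, v ∈ ℓ → F ℓ →
      ∃ a ∈ S, ∃ b ∈ S, a ∈ ℓ ∧ b ∈ ℓ ∧ a ≠ v ∧ b ≠ v ∧ a ≠ b := by
    intro v hv ℓ hvℓ hFℓ
    have h : 1 < #(({w ∈ S | w ∈ ℓ} : Finset P).erase v) := by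
      rw [Finset.card_erase_of_mem (by simp [hv, hvℓ]), hline v hv ℓ hvℓ hFℓ]
      omega
    obtain ⟨a, ha, b, hb, hab⟩ := Finset.one_lt_card.1 h
    simp only [Finset.mem_erase, Finset.mem_filter] at ha hb
    exact ⟨a, ha.2.1, b, hb.2.1, ha.2.2, hb.2.2, ha.1, hb.1, hab⟩
  refine ⟨⟨S, {ℓ | F ℓ ∧ ∃ v ∈ S, v ∈ ℓ}, ?_, ?_, ?_⟩, ?_, rfl⟩
  · intro v hv w hw hne
    have h := HasLines.mkLine_ax (L := L) hne
    refine ⟨HasLines.mkLine hne, ⟨⟨hF v hv w hw hne _ h.1 h.2, v, hv, h.1⟩, h⟩, ?_⟩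
    rintro ℓ ⟨-, hvℓ, hwℓ⟩
    exact (Nondegenerate.eq_or_eq hvℓ hwℓ h.1 h.2).resolve_left hne
  · rintro ℓ₁ ⟨hF₁, x₁, hx₁, hxℓ₁⟩ ℓ₂ ⟨hF₂, x₂, hx₂, hxℓ₂⟩ hne
    obtain ⟨a, ha, haℓ, haℓ'⟩ : ∃ a ∈ S, a ∈ ℓ₁ ∧ a ∈ ℓ₂ := by
      by_cases hx : x₁ ∈ ℓ₂
      · exact ⟨x₁, hx₁, hxℓ₁, hx⟩
      · obtain ⟨p, hp, hp₂, hp₁⟩ := hmeet x₁ hx₁ ℓ₁ hxℓ₁ hF₁ x₂ hx₂ ℓ₂ hxℓ₂ hF₂ hx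
        exact ⟨p, hp, hp₁, hp₂⟩
    refine ⟨a, ⟨ha, haℓ, haℓ'⟩, ?_⟩
    rintro b ⟨-, hbℓ, hbℓ'⟩
    exact (Nondegenerate.eq_or_eq hbℓ haℓ hbℓ' haℓ').resolve_right hne
  · obtain ⟨v, hv⟩ : S.Nonempty := Finset.card_pos.1 (by omega)
    obtain ⟨ℓ₁, h₁, ℓ₂, h₂, hne⟩ := Finset.one_lt_card.1
      (show 1 < #{ℓ : L | v ∈ ℓ ∧ F ℓ} by rw [hcard v hv]; omega)
    simp only [Finset.mem_filter, Finset.mem_univ, true_and] at h₁ h₂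
    obtain ⟨a, ha, b, hb, haℓ, hbℓ, hav, hbv, hab⟩ := htwo v hv ℓ₁ h₁.1 h₁.2
    obtain ⟨c, hc, d, hd, hcℓ, hdℓ, hcv, hdv, hcd⟩ := htwo v hv ℓ₂ h₂.1 h₂.2
    have hoff₁ : ∀ x, x ∈ ℓ₂ → x ≠ v → x ∉ ℓ₁ := fun x hx hxv hx' =>
      (Nondegenerate.eq_or_eq hx' h₁.1 hx h₂.1).elim hxv hne
    have hoff₂ : ∀ x, x ∈ ℓ₁ → x ≠ v → x ∉ ℓ₂ := fun x hx hxv hx' =>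
      hoff₁ x hx' hxv hx
    have hline₁ : ∀ m : L, a ∈ m → b ∈ m → m = ℓ₁ := fun m ham hbm =>
      (Nondegenerate.eq_or_eq ham hbm haℓ hbℓ).resolve_left hab
    have hline₂ : ∀ m : L, c ∈ m → d ∈ m → m = ℓ₂ := fun m hcm hdm =>
      (Nondegenerate.eq_or_eq hcm hdm hcℓ hdℓ).resolve_left hcd
    have hc₁ := hoff₁ c hcℓ hcv
    have hd₁ := hoff₁ d hdℓ hdv
    have ha₂ := hoff₂ a haℓ hav
    have hb₂ := hoff₂ b hbℓ hbv
    refine ⟨a, b, c, d, ha, hb, hc, hd, hab, ?_, ?_, ?_, ?_, hcd, ?_⟩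
    · rintro rfl; exact hc₁ haℓ
    · rintro rfl; exact hd₁ haℓ
    · rintro rfl; exact hc₁ hbℓ
    · rintro rfl; exact hd₁ hbℓ
    · intro m _
      refine ⟨?_, ?_, ?_, ?_⟩
      · rintro ⟨h, h', h''⟩; exact hc₁ (hline₁ m h h' ▸ h'')
      · rintro ⟨h, h', h''⟩; exact hd₁ (hline₁ m h h' ▸ h'')
      · rintro ⟨h, h', h''⟩; exact ha₂ (hline₂ m h' h'' ▸ h)
      · rintro ⟨h, h', h''⟩; exact hb₂ (hline₂ m h' h'' ▸ h)
  · rintro ℓ ⟨hFℓ, v, hv, hvℓ⟩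
    have h := hline v hv ℓ hvℓ hFℓ
    rw [← Set.ncard_coe_finset, Finset.coe_filter] at h
    exact h

end

/-- If `n > 1`, `q > n² + n`, and `φ` is an embedding of `K_{q-n, n²+n+1}` into a finite
projective plane of order `q`, then the image of the class `V` of size `n²+n+1` is either
contained in a single line, or is exactly the point set of a subplane of order `n`. -/
theorem embedding_class_line_or_subplane {P L : Type*} [Fintype P] [Fintype L]
    [Membership P L] [Configuration.ProjectivePlane P L] (n q : ℕ)
    (hn : 1 < n) (hq' : n ^ 2 + n < q)
    (hq : Configuration.ProjectivePlane.order P L = q)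
    (φ : Fin (q - n) ⊕ Fin (n ^ 2 + n + 1) → P)
    (hφ : IsGraphEmbedding
      (completeBipartiteGraph (Fin (q - n)) (Fin (n ^ 2 + n + 1))) P L φ) :
    (∃ ℓ : L, ∀ v : Fin (n ^ 2 + n + 1), φ (Sum.inr v) ∈ ℓ) ∨
      (∃ S : Subplane P L, S.HasOrder n ∧
        S.points = Set.range fun v : Fin (n ^ 2 + n + 1) => φ (Sum.inr v)) := by
  classical
  obtain ⟨hinj, hedge⟩ := hφ
  have huv : ∀ u v u' v', ∀ ℓ : L, φ (.inl u) ∈ ℓ → φ (.inr v) ∈ ℓ → φ (.inl u') ∈ ℓ →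
      φ (.inr v') ∈ ℓ → u = u' ∧ v = v' := by
    intro u v u' v' ℓ h₁ h₂ h₃ h₄
    have h := hedge s(.inl u, .inr v) (by simp) s(.inl u', .inr v') (by simp) ℓ
      (by simp [h₁, h₂]) (by simp [h₃, h₄])
    simpa using h
  set f : Fin (n ^ 2 + n + 1) → P := fun v => φ (.inr v)
  set g : Fin (q - n) → P := fun u => φ (.inl u)
  have hf : Function.Injective f := hinj.comp Sum.inr_injective
  have hg : Function.Injective g := hinj.comp Sum.inl_injective
  refine or_iff_not_imp_left.2 fun hnot => ?_
  push Not at hnot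
  obtain ⟨A, hA, hpoints⟩ := exists_subplane_of_card_lines (L := L) hn
    (S := Finset.univ.image f) (F := fun ℓ => ∀ u ∈ Finset.univ.image g, u ∉ ℓ)
    (by rw [Finset.card_image_of_injective _ hf, Finset.card_fin])
    (by
      simp only [Finset.mem_image, Finset.mem_univ, true_and, forall_exists_index,
        forall_apply_eq_imp_iff]
      intro v w hne ℓ hv hw u hu
      exact hne (congrArg f (huv u v u w ℓ hu hv hu hw).2))
    (by
      simp only [Finset.mem_image, Finset.mem_univ, true_and, forall_exists_index,
        forall_apply_eq_imp_iff]
      intro v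
      have h := card_lines_avoiding_add_card (L := L) (Finset.univ.image g) (f v)
        (by
          simp only [Finset.mem_image, Finset.mem_univ, true_and, not_exists]
          intro u hu
          exact Sum.inl_ne_inr (hinj hu))
        (by
          simp only [Finset.mem_image, Finset.mem_univ, true_and, forall_exists_index,
            forall_apply_eq_imp_iff]
          intro u w ℓ hv hu hw
          exact congrArg g (huv u v w v ℓ hu hv hw hv).1)
      rw [Finset.card_image_of_injective _ hg, Finset.card_fin, hq] at h
      simp only [Finset.mem_image, Finset.mem_univ, true_and, forall_exists_index,
        forall_apply_eq_imp_iff] at h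
      have : n ≤ n ^ 2 + n := Nat.le_add_left _ _
      omega)
    (by
      intro ℓ
      obtain ⟨v, hv⟩ := hnot ℓ
      exact ⟨f v, by simp, hv⟩)
  exact ⟨A, hA, by simpa using hpoints⟩
end

section
/- Let π be a finite projective plane of order q and let n > 1 be a natural number. Let s and t be natural numbers with s ≥ q - n and t > n² + n + 1, and let φ be an embedding of the complete bipartite graph K_{s,t} into π, with classes U of size s and V of size t. Then φ(V) is contained in the point set of a single line of π. -/
open Configuration in
/-- A finite set `W` of more than `n ^ 2 + n + 1` points, each of which lies on at most `n + 1`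
lines meeting `W` in a further point, is contained in a line. -/
theorem Configuration.exists_line_of_card_secants_le {P L : Type*} [Fintype L] [Membership P L]
    [HasLines P L] (n : ℕ) (W : Finset P) (hW : n ^ 2 + n + 1 < W.card)
    (hsec : ∀ v ∈ W, Nat.card {l : L // v ∈ l ∧ ∃ w ∈ W, w ≠ v ∧ w ∈ l} ≤ n + 1) :
    ∃ l : L, ∀ w ∈ W, w ∈ l := by
  classical
  obtain ⟨v, hv⟩ : W.Nonempty := Finset.card_pos.mp (by omega)
  have hjoin : ∀ a b : P, ∃ l : L, a ≠ b → a ∈ l ∧ b ∈ l := by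
    intro a b
    by_cases h : a = b
    · obtain ⟨l, -⟩ := Nondegenerate.exists_line (L := L) a
      exact ⟨l, fun h' => absurd h h'⟩
    · exact ⟨HasLines.mkLine h, fun _ => HasLines.mkLine_ax h⟩
  choose join hjoin using hjoin
  have join_left {a b : P} (h : a ≠ b) : a ∈ join a b := (hjoin a b h).1
  have join_right {a b : P} (h : a ≠ b) : b ∈ join a b := (hjoin a b h).2
  let secants (v : P) : Finset L := {l : L | v ∈ l ∧ ∃ w ∈ W, w ≠ v ∧ w ∈ l}
  have card_secants (v : P) (hv : v ∈ W) : (secants v).card ≤ n + 1 := by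
    have := hsec v hv
    rwa [Nat.card_eq_fintype_card, Fintype.card_subtype] at this
  have join_mem (v w : P) (hw : w ∈ W) (h : w ≠ v) : join v w ∈ secants v := by
    simp only [secants, Finset.mem_filter, Finset.mem_univ, true_and]
    exact ⟨join_left h.symm, w, hw, h, join_right h.symm⟩
  obtain ⟨l, hl, hcard⟩ := Finset.exists_lt_card_fiber_of_mul_lt_card_of_maps_to
    (s := W.erase v) (t := secants v) (f := fun w => join v w) (n := n)
    (fun w hw => join_mem v w (Finset.mem_of_mem_erase hw) (Finset.ne_of_mem_erase hw)) (by
      rw [Finset.card_erase_of_mem hv]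
      have := Nat.mul_le_mul_right n (card_secants v hv)
      have h : (n + 1) * n = n ^ 2 + n := by ring
      omega)
  have hvl : v ∈ l := (Finset.mem_filter.mp hl).2.1
  refine ⟨l, fun w hw => by_contra fun hwl => ?_⟩
  set F : Finset P := insert v {x ∈ W.erase v | join v x = l} with hF
  have hFcard : n + 2 ≤ F.card := by
    rw [hF, Finset.card_insert_of_notMem (by simp)]
    omega
  have hFl : ∀ x ∈ F, x ∈ W ∧ x ∈ l := by
    intro x hx
    rcases Finset.mem_insert.mp hx with rfl | hx
    · exact ⟨hv, hvl⟩
    · obtain ⟨hx, hxl⟩ := Finset.mem_filter.mp hx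
      exact ⟨Finset.mem_of_mem_erase hx, hxl ▸ join_right (Finset.ne_of_mem_erase hx).symm⟩
  have hne : ∀ x ∈ F, x ≠ w := fun x hx h => hwl (h ▸ (hFl x hx).2)
  have hle : F.card ≤ (secants w).card :=
    Finset.card_le_card_of_injOn (fun x => join w x)
      (fun x hx => join_mem w x (hFl x hx).1 (hne x hx)) (by
        intro a ha b hb hab
        have hab : join w a = join w b := hab
        have hb' : b ∈ join w a := hab ▸ join_right (hne b hb).symm
        refine (Nondegenerate.eq_or_eq (hFl a ha).2 (hFl b hb).2
          (join_right (hne a ha).symm) hb').resolve_right fun h => hwl ?_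
        exact h ▸ join_left (hne a ha).symm)
  have := card_secants w hw
  omega

open Configuration in
/-- If a complete bipartite graph is embedded in a projective plane of order `q`, then through the
image of a vertex of one class there are at most `q + 1 - s` lines containing the image of another
vertex of the same class, where `s` is the size of the opposite class. -/
theorem IsGraphEmbedding.card_secants_add_le {P L : Type*} [Fintype P] [Fintype L]
    [Membership P L] [ProjectivePlane P L] {U V : Type*} [Finite U] {φ : U ⊕ V → P}
    (hφ : IsGraphEmbedding (completeBipartiteGraph U V) P L φ) (v : V) :
    Nat.card {l : L // φ (.inr v) ∈ l ∧ ∃ w, w ≠ v ∧ φ (.inr w) ∈ l} + Nat.card U ≤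
      ProjectivePlane.order P L + 1 := by
  classical
  have hne (u : U) : φ (.inr v) ≠ φ (.inl u) := fun h => by simpa using hφ.1 h
  have hedge (u : U) (w u' w') (l : L) (h₁ : φ (.inl u) ∈ l) (h₂ : φ (.inr w) ∈ l)
      (h₃ : φ (.inl u') ∈ l) (h₄ : φ (.inr w') ∈ l) : u = u' ∧ w = w' := by
    have := hφ.2 s(.inl u, .inr w) (by simp) s(.inl u', .inr w') (by simp) l
      (by simp [h₁, h₂]) (by simp [h₃, h₄])
    simpa using this
  rw [← ProjectivePlane.lineCount_eq (L := L) (φ (.inr v)), lineCount, ← Nat.card_sum]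
  refine Nat.card_le_card_of_injective
    (Sum.elim (fun l => ⟨l.1, l.2.1⟩)
      fun u => ⟨HasLines.mkLine (hne u), (HasLines.mkLine_ax (hne u)).1⟩) ?_
  refine Function.Injective.sumElim ?_ ?_ ?_
  · intro l l' h
    exact Subtype.ext (Subtype.mk.inj h)
  · intro u u' h
    have h : (HasLines.mkLine (hne u) : L) = HasLines.mkLine (hne u') := congrArg Subtype.val h
    have hu := HasLines.mkLine_ax (L := L) (hne u)
    exact (hedge u v u' v _ hu.2 hu.1 (h ▸ (HasLines.mkLine_ax (hne u')).2) hu.1).1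
  · rintro ⟨l, hl, w, hwv, hw⟩ u h
    have h : l = HasLines.mkLine (hne u) := congrArg Subtype.val h
    have hu : φ (.inl u) ∈ l := h ▸ (HasLines.mkLine_ax (hne u)).2
    exact hwv (hedge u w u v l hu hw hu hl).2

/-- If `n > 1`, `s ≥ q - n`, `t > n² + n + 1`, and `φ` is an embedding of `K_{s,t}` into a
finite projective plane of order `q`, then the image of the class `V` of size `t` is
contained in a single line. -/
theorem embedding_large_class_collinear {P L : Type*} [Fintype P] [Fintype L]
    [Membership P L] [Configuration.ProjectivePlane P L] (n q s t : ℕ)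
    (hn : 1 < n) (hs : q - n ≤ s) (ht : n ^ 2 + n + 1 < t)
    (hq : Configuration.ProjectivePlane.order P L = q)
    (φ : Fin s ⊕ Fin t → P)
    (hφ : IsGraphEmbedding (completeBipartiteGraph (Fin s) (Fin t)) P L φ) :
    ∃ ℓ : L, ∀ v : Fin t, φ (Sum.inr v) ∈ ℓ := by
  classical
  have hinj : Function.Injective (fun v : Fin t => φ (Sum.inr v)) :=
    hφ.1.comp Sum.inr_injective
  obtain ⟨l, hl⟩ := Configuration.exists_line_of_card_secants_le (L := L) n
    (Finset.univ.image fun v : Fin t => φ (Sum.inr v))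
    (by rwa [Finset.card_image_of_injective _ hinj, Finset.card_fin]) (by
      simp only [Finset.mem_image, Finset.mem_univ, true_and, exists_exists_eq_and,
        forall_exists_index, forall_apply_eq_imp_iff, hinj.ne_iff]
      intro v
      have := hφ.card_secants_add_le v
      rw [hq, Nat.card_fin] at this
      omega)
  exact ⟨l, fun v => hl _ (Finset.mem_image_of_mem _ (Finset.mem_univ v))⟩
end

section
/- Let q ≥ 2 be a natural number, let Π be a finite projective plane of order q², let B be a Baer subplane of Π (that is, a subplane of order q), and let φ be an embedding of the complete bipartite graph K_{q²,q²} into Π. If q > 2, then at most q² of the image points of φ lie in the point set of B; if q = 2, then at most q² + 1 = 5 of the image points of φ lie in the point set of B. -/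
open Configuration in
/-- In a projective plane of order `n`, suppose the `n * n` lines joining the points `a i` to the
points `b j` are pairwise distinct. Then the points `a i` are collinear. -/
theorem exists_line_of_joins_injective {P L : Type*} [Fintype P] [Fintype L]
    [Membership P L] [ProjectivePlane P L] {n : ℕ} (hn : 2 ≤ n)
    (horder : ProjectivePlane.order P L = n) {a b : Fin n → P}
    (ha : Function.Injective a) (hab : ∀ i j, a i ≠ b j)
    (hinj : ∀ i j i' j' (ℓ : L), a i ∈ ℓ → b j ∈ ℓ → a i' ∈ ℓ → b j' ∈ ℓ → i = i' ∧ j = j') :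
    ∃ m : L, ∀ i, a i ∈ m := by
  classical
  let i₀ : Fin n := ⟨0, by omega⟩
  let i₁ : Fin n := ⟨1, by omega⟩
  have h01 : i₀ ≠ i₁ := by simp [i₀, i₁]
  obtain ⟨m, hm₀, hm₁⟩ : ∃ m : L, a i₀ ∈ m ∧ a i₁ ∈ m :=
    ⟨_, HasLines.mkLine_ax (ha.ne h01)⟩
  refine ⟨m, fun i ↦ ?_⟩
  rcases eq_or_ne i₀ i with rfl | hi
  · exact hm₀
  choose f hf using fun j ↦
    (⟨_, HasLines.mkLine_ax (hab i₀ j)⟩ : ∃ l : L, a i₀ ∈ l ∧ b j ∈ l)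
  have hf_inj : Function.Injective f := fun j j' h ↦
    (hinj i₀ j i₀ j' (f j) (hf j).1 (hf j).2 (hf j).1 (h ▸ (hf j').2)).2
  have hm : m ∉ Finset.univ.image f := by
    simp only [Finset.mem_image, Finset.mem_univ, true_and, not_exists]
    rintro j rfl
    exact h01 (hinj i₀ j i₁ j _ hm₀ (hf j).2 hm₁ (hf j).2).1
  have hpencil : insert m (Finset.univ.image f) = Finset.univ.filter (fun l : L ↦ a i₀ ∈ l) := by
    apply Finset.eq_of_subset_of_card_le
    · intro l hl
      simp only [Finset.mem_insert, Finset.mem_image, Finset.mem_univ, true_and] at hl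
      simp only [Finset.mem_filter, Finset.mem_univ, true_and]
      rcases hl with rfl | ⟨j, rfl⟩
      · exact hm₀
      · exact (hf j).1
    · have hcount := ProjectivePlane.lineCount_eq (L := L) (a i₀)
      rw [lineCount, Nat.card_eq_fintype_card, Fintype.card_subtype, horder] at hcount
      rw [hcount, Finset.card_insert_of_notMem hm, Finset.card_image_of_injective _ hf_inj,
        Finset.card_univ, Fintype.card_fin]
  obtain ⟨l, hl₀, hl⟩ : ∃ l : L, a i₀ ∈ l ∧ a i ∈ l := ⟨_, HasLines.mkLine_ax (ha.ne hi)⟩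
  have hmem : l ∈ insert m (Finset.univ.image f) := by simp [hpencil, hl₀]
  simp only [Finset.mem_insert, Finset.mem_image, Finset.mem_univ, true_and] at hmem
  rcases hmem with rfl | ⟨j, rfl⟩
  · exact hl
  · exact absurd (hinj i₀ j i j _ hl₀ (hf j).2 hl (hf j).2).1 hi

open Configuration in
/-- A line outside a subplane contains at most one point of the subplane. -/
theorem Subplane.ncard_inter_le_one {P L : Type*} [Finite P] [Membership P L]
    [Nondegenerate P L] (B : Subplane P L) {ℓ : L} (hℓ : ℓ ∉ B.lines) :
    {p ∈ B.points | p ∈ ℓ}.ncard ≤ 1 := by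
  rw [Set.ncard_le_one]
  rintro p ⟨hpB, hp⟩ r ⟨hrB, hr⟩
  by_contra hne
  obtain ⟨k, ⟨hk, hpk, hrk⟩, -⟩ := B.exists_unique_line p hpB r hrB hne
  rcases Nondegenerate.eq_or_eq hp hr hpk hrk with h | rfl
  · exact hne h
  · exact hℓ hk

open Configuration in
/-- Two distinct lines contain together at most `q ^ 2` points of a subplane of order `q ≥ 2`,
apart from their point of intersection. -/
theorem Subplane.HasOrder.ncard_inter_add_ncard_inter_le {P L : Type*} [Finite P]
    [Membership P L] [Nondegenerate P L] {B : Subplane P L} {q : ℕ} (hB : B.HasOrder q)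
    (hq : 2 ≤ q) {ℓ m : L} (hne : ℓ ≠ m) :
    {p ∈ B.points | p ∈ ℓ ∧ p ∉ m}.ncard + {p ∈ B.points | p ∈ m ∧ p ∉ ℓ}.ncard ≤ q ^ 2 := by
  have hsub : ∀ k k' : L,
      {p ∈ B.points | p ∈ k ∧ p ∉ k'}.ncard ≤ {p ∈ B.points | p ∈ k}.ncard := fun k k' ↦
    Set.ncard_le_ncard fun p hp ↦ ⟨hp.1, hp.2.1⟩
  have hbound : ∀ k : L, {p ∈ B.points | p ∈ k}.ncard ≤ q + 1 := fun k ↦ by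
    by_cases hk : k ∈ B.lines
    · exact (hB k hk).le
    · exact (B.ncard_inter_le_one hk).trans (by omega)
  have h₁ := hsub ℓ m
  have h₂ := hsub m ℓ
  have h₃ := hbound ℓ
  have h₄ := hbound m
  by_cases hℓB : ℓ ∈ B.lines
  · by_cases hmB : m ∈ B.lines
    · obtain ⟨x, ⟨hxB, hxℓ, hxm⟩, -⟩ := B.exists_unique_point ℓ hℓB m hmB hne
      have hlt : ∀ k k' : L, x ∈ k → x ∈ k' →
          {p ∈ B.points | p ∈ k ∧ p ∉ k'}.ncard < {p ∈ B.points | p ∈ k}.ncard :=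
        fun k k' hk hk' ↦ Set.ncard_lt_ncard
          ⟨fun p hp ↦ ⟨hp.1, hp.2.1⟩, fun h ↦ (h ⟨hxB, hk⟩ : _ ∧ _ ∧ _).2.2 hk'⟩
      have h₅ := hlt ℓ m hxℓ hxm
      have h₆ := hlt m ℓ hxm hxℓ
      nlinarith
    · have := B.ncard_inter_le_one hmB
      nlinarith
  · have := B.ncard_inter_le_one hℓB
    nlinarith

/-- Let `Π` be a finite projective plane of order `q²` (`q ≥ 2`), `B` a Baer subplane of `Π`
(a subplane of order `q`), and `φ` an embedding of `K_{q²,q²}` into `Π`. If `q > 2` then at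
most `q²` of the image points of `φ` lie in `B`; if `q = 2` then at most `q² + 1` of the
image points of `φ` lie in `B`. -/
theorem baer_subplane_point_bound {P L : Type*} [Fintype P] [Fintype L]
    [Membership P L] [Configuration.ProjectivePlane P L] (q : ℕ) (hq2 : 2 ≤ q)
    (hq : Configuration.ProjectivePlane.order P L = q ^ 2)
    (B : Subplane P L) (hB : B.HasOrder q)
    (φ : Fin (q ^ 2) ⊕ Fin (q ^ 2) → P)
    (hφ : IsGraphEmbedding (completeBipartiteGraph (Fin (q ^ 2)) (Fin (q ^ 2))) P L φ) :
    (2 < q → (Set.range φ ∩ B.points).ncard ≤ q ^ 2) ∧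
    (q = 2 → (Set.range φ ∩ B.points).ncard ≤ q ^ 2 + 1) := by
  suffices h : (Set.range φ ∩ B.points).ncard ≤ q ^ 2 from
    ⟨fun _ ↦ h, fun _ ↦ h.trans (Nat.le_succ _)⟩
  obtain ⟨hφ_inj, hφ_edge⟩ := hφ
  have hn : 2 ≤ q ^ 2 := by nlinarith
  have hinj : ∀ i j i' j' (ℓ : L), φ (.inl i) ∈ ℓ → φ (.inr j) ∈ ℓ → φ (.inl i') ∈ ℓ →
      φ (.inr j') ∈ ℓ → i = i' ∧ j = j' := by
    intro i j i' j' ℓ h₁ h₂ h₃ h₄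
    have := hφ_edge s(.inl i, .inr j) (by simp) s(.inl i', .inr j') (by simp) ℓ
      (by simp [h₁, h₂]) (by simp [h₃, h₄])
    simpa using this
  obtain ⟨ℓ, hℓ⟩ := exists_line_of_joins_injective (L := L) (a := fun i ↦ φ (.inl i))
    (b := fun j ↦ φ (.inr j)) hn hq (hφ_inj.comp Sum.inl_injective)
    (fun i j h ↦ by simpa using hφ_inj h) hinj
  obtain ⟨m, hm⟩ := exists_line_of_joins_injective (L := L) (a := fun j ↦ φ (.inr j))
    (b := fun i ↦ φ (.inl i)) hn hq (hφ_inj.comp Sum.inr_injective)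
    (fun i j h ↦ by simpa using hφ_inj h)
    (fun j i j' i' k h₁ h₂ h₃ h₄ ↦ (hinj i j i' j' k h₂ h₁ h₄ h₃).symm)
  let i₀ : Fin (q ^ 2) := ⟨0, by omega⟩
  let i₁ : Fin (q ^ 2) := ⟨1, by omega⟩
  have h01 : i₀ ≠ i₁ := by simp [i₀, i₁]
  have hℓm : ∀ i, φ (.inl i) ∉ m := fun i h ↦
    h01 (hinj i i₀ i i₁ m h (hm _) h (hm _)).2
  have hmℓ : ∀ j, φ (.inr j) ∉ ℓ := fun j h ↦
    h01 (hinj i₀ j i₁ j ℓ (hℓ _) h (hℓ _) h).1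
  have hne : ℓ ≠ m := fun h ↦ hℓm i₀ (h ▸ hℓ i₀)
  have hcover : Set.range φ ∩ B.points ⊆
      {p ∈ B.points | p ∈ ℓ ∧ p ∉ m} ∪ {p ∈ B.points | p ∈ m ∧ p ∉ ℓ} := by
    rintro _ ⟨⟨i | j, rfl⟩, hp⟩
    · exact Or.inl ⟨hp, hℓ i, hℓm i⟩
    · exact Or.inr ⟨hp, hm j, hmℓ j⟩
  exact (Set.ncard_le_ncard hcover).trans
    ((Set.ncard_union_le _ _).trans (hB.ncard_inter_add_ncard_inter_le hq2 hne))
end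

section
/- Let q ≥ 2 be a natural number, let Π be a finite projective plane of order q², let B be a Baer subplane of Π (that is, a subplane of order q), and let φ be an embedding of the complete bipartite graph K_{q²,q²} into Π. Then at least q of the lines of the form φ̄(e), where e ranges over the edges of K_{q²,q²} and φ̄ is the induced map on edges, belong to the line set of B. -/
/-- The points and lines of a subplane form a projective plane. -/
@[reducible]
noncomputable def Subplane.toProjectivePlane {P L : Type*} [Membership P L]
    [Configuration.ProjectivePlane P L] (S : Subplane P L)
    [Membership S.points S.lines] (hmem : ∀ (p : S.points) (ℓ : S.lines), p ∈ ℓ ↔ p.1 ∈ ℓ.1) :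
    Configuration.ProjectivePlane S.points S.lines := by
  have line : ∀ {p₁ p₂ : S.points}, p₁ ≠ p₂ → ∃ ℓ : S.lines, p₁ ∈ ℓ ∧ p₂ ∈ ℓ := by
    intro p₁ p₂ h
    obtain ⟨ℓ, ⟨hℓ, h₁, h₂⟩, -⟩ :=
      S.exists_unique_line p₁ p₁.2 p₂ p₂.2 (Subtype.coe_injective.ne h)
    exact ⟨⟨ℓ, hℓ⟩, (hmem _ _).2 h₁, (hmem _ _).2 h₂⟩
  have point : ∀ {ℓ₁ ℓ₂ : S.lines}, ℓ₁ ≠ ℓ₂ → ∃ p : S.points, p ∈ ℓ₁ ∧ p ∈ ℓ₂ := by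
    intro ℓ₁ ℓ₂ h
    obtain ⟨p, ⟨hp, h₁, h₂⟩, -⟩ :=
      S.exists_unique_point ℓ₁ ℓ₁.2 ℓ₂ ℓ₂.2 (Subtype.coe_injective.ne h)
    exact ⟨⟨p, hp⟩, (hmem _ _).2 h₁, (hmem _ _).2 h₂⟩
  have eq_or_eq : ∀ {p₁ p₂ : S.points} {ℓ₁ ℓ₂ : S.lines},
      p₁ ∈ ℓ₁ → p₂ ∈ ℓ₁ → p₁ ∈ ℓ₂ → p₂ ∈ ℓ₂ → p₁ = p₂ ∨ ℓ₁ = ℓ₂ := by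
    intro p₁ p₂ ℓ₁ ℓ₂ h₁ h₂ h₃ h₄
    rw [hmem] at h₁ h₂ h₃ h₄
    exact (Configuration.Nondegenerate.eq_or_eq h₁ h₂ h₃ h₄).imp Subtype.ext Subtype.ext
  have frame : ∃ a b c d : S.points, a ≠ b ∧ a ≠ c ∧ b ≠ c ∧ c ≠ d ∧
      ∀ ℓ : S.lines, ¬(a ∈ ℓ ∧ b ∈ ℓ ∧ c ∈ ℓ) ∧ ¬(a ∈ ℓ ∧ b ∈ ℓ ∧ d ∈ ℓ) ∧
        ¬(a ∈ ℓ ∧ c ∈ ℓ ∧ d ∈ ℓ) ∧ ¬(b ∈ ℓ ∧ c ∈ ℓ ∧ d ∈ ℓ) := by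
    obtain ⟨a, b, c, d, ha, hb, hc, hd, hab, hac, -, hbc, -, hcd, h⟩ := S.nondegenerate
    refine ⟨⟨a, ha⟩, ⟨b, hb⟩, ⟨c, hc⟩, ⟨d, hd⟩, by simpa, by simpa, by simpa, by simpa,
      fun ℓ => ?_⟩
    simpa only [hmem] using h ℓ ℓ.2
  refine
    { exists_point := ?_
      exists_line := ?_
      eq_or_eq := eq_or_eq
      mkPoint := fun h => (point h).choose
      mkPoint_ax := fun h => (point h).choose_spec
      mkLine := fun h => (line h).choose
      mkLine_ax := fun h => (line h).choose_spec
      exists_config := ?_ }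
  · intro ℓ
    obtain ⟨a, b, c, _, -, -, -, -, h⟩ := frame
    by_contra! hℓ
    exact (h ℓ).1 ⟨hℓ a, hℓ b, hℓ c⟩
  · intro p
    obtain ⟨a, b, c, _, hab, hac, hbc, -, h⟩ := frame
    obtain ⟨ab, ha, hb⟩ := line hab
    obtain ⟨ac, ha', hc⟩ := line hac
    obtain ⟨bc, hb', hc'⟩ := line hbc
    by_contra! hp
    rcases eq_or_eq ha (hp ab) ha' (hp ac) with rfl | rfl
    · exact (h bc).1 ⟨hp bc, hb', hc'⟩
    · exact (h ab).1 ⟨ha, hb, hc⟩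
  · obtain ⟨a, b, c, d, hab, hac, -, hcd, h⟩ := frame
    obtain ⟨ab, ha, hb⟩ := line hab
    obtain ⟨ac, ha', hc⟩ := line hac
    obtain ⟨cd, hc', hd⟩ := line hcd
    exact ⟨d, a, b, cd, ab, ac, fun hx => (h ab).2.1 ⟨ha, hb, hx⟩,
      fun hx => (h ac).2.2.1 ⟨ha', hc, hx⟩, fun hx => (h cd).2.2.1 ⟨hx, hc', hd⟩, ha, ha',
      fun hx => (h cd).2.2.2 ⟨hx, hc', hd⟩, hb, fun hx => (h ac).1 ⟨ha', hx, hc⟩⟩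

theorem Subplane.HasOrder.ncard_lines {P L : Type*} [Finite P] [Finite L] [Membership P L]
    [Configuration.ProjectivePlane P L] {S : Subplane P L} {n : ℕ} (hS : S.HasOrder n) :
    S.lines.ncard = n ^ 2 + n + 1 := by
  let : Membership S.points S.lines := ⟨fun ℓ p => p.1 ∈ ℓ.1⟩
  let := S.toProjectivePlane fun _ _ => Iff.rfl
  have := Fintype.ofFinite S.lines
  obtain ⟨-, -, -, ℓ, -⟩ :=
    Configuration.ProjectivePlane.exists_config (P := S.points) (L := S.lines)
  have hcount := Configuration.ProjectivePlane.pointCount_eq S.points ℓ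
  have hncard : Configuration.pointCount S.points ℓ = n + 1 := by
    rw [← hS ℓ ℓ.2, ← Nat.card_coe_set_eq]
    exact Nat.card_congr (Equiv.subtypeSubtypeEquivSubtypeInter (· ∈ S.points) (· ∈ ℓ.1))
  have horder : Configuration.ProjectivePlane.order S.points S.lines = n := by lia
  rw [← Nat.card_coe_set_eq, Nat.card_eq_fintype_card,
    Configuration.ProjectivePlane.card_lines S.points S.lines, horder]

/-- An embedding of `K_{m,n}` induces at least `m * n` lines. -/
theorem IsGraphEmbedding.mul_le_ncard_lines {P L : Type*} [Finite L] [Membership P L]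
    [Configuration.HasLines P L] {m n : ℕ} {φ : Fin m ⊕ Fin n → P}
    (hφ : IsGraphEmbedding (completeBipartiteGraph (Fin m) (Fin n)) P L φ) :
    m * n ≤ Set.ncard {ℓ : L | ∃ a b : Fin m ⊕ Fin n,
      (completeBipartiteGraph (Fin m) (Fin n)).Adj a b ∧ φ a ∈ ℓ ∧ φ b ∈ ℓ} := by
  have hne (x : Fin m × Fin n) : φ (.inl x.1) ≠ φ (.inr x.2) := hφ.1.ne Sum.inl_ne_inr
  have hmk (x : Fin m × Fin n) :=
    Configuration.HasLines.mkLine_ax (L := L) (hne x)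
  have hinj : Function.Injective fun x : Fin m × Fin n =>
      (Configuration.HasLines.mkLine (hne x) : L) := by
    intro x y hxy
    have hy := hmk y
    dsimp only at hxy
    rw [← hxy] at hy
    have := hφ.2 s(.inl x.1, .inr x.2) (by simp) s(.inl y.1, .inr y.2) (by simp) _
      (by simpa using hmk x) (by simpa using hy)
    simpa [Prod.ext_iff] using this
  calc m * n = (Set.range fun x => (Configuration.HasLines.mkLine (hne x) : L)).ncard := by
        rw [← Set.image_univ, Set.ncard_image_of_injective _ hinj]
        simp [Set.ncard_univ]
    _ ≤ _ := Set.ncard_le_ncard <| by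
        rintro _ ⟨x, rfl⟩
        exact ⟨_, _, by simp, hmk x⟩

/-- Let `Π` be a finite projective plane of order `q²` (`q ≥ 2`), `B` a Baer subplane of `Π`
(a subplane of order `q`), and `φ` an embedding of `K_{q²,q²}` into `Π`. Then at least `q`
of the lines induced by the edges of `K_{q²,q²}` (the unique lines through the images of two
adjacent vertices) belong to the line set of `B`. -/
theorem baer_subplane_line_bound {P L : Type*} [Fintype P] [Fintype L]
    [Membership P L] [Configuration.ProjectivePlane P L] (q : ℕ) (hq2 : 2 ≤ q)
    (hq : Configuration.ProjectivePlane.order P L = q ^ 2)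
    (B : Subplane P L) (hB : B.HasOrder q)
    (φ : Fin (q ^ 2) ⊕ Fin (q ^ 2) → P)
    (hφ : IsGraphEmbedding (completeBipartiteGraph (Fin (q ^ 2)) (Fin (q ^ 2))) P L φ) :
    q ≤ Set.ncard {ℓ ∈ B.lines |
        ∃ a b : Fin (q ^ 2) ⊕ Fin (q ^ 2),
          (completeBipartiteGraph (Fin (q ^ 2)) (Fin (q ^ 2))).Adj a b ∧
          φ a ∈ ℓ ∧ φ b ∈ ℓ} := by
  set E : Set L := {ℓ | ∃ a b : Fin (q ^ 2) ⊕ Fin (q ^ 2),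
    (completeBipartiteGraph (Fin (q ^ 2)) (Fin (q ^ 2))).Adj a b ∧ φ a ∈ ℓ ∧ φ b ∈ ℓ}
  change q ≤ (B.lines ∩ E).ncard
  have hE : q ^ 2 * q ^ 2 ≤ E.ncard := hφ.mul_le_ncard_lines
  have hL := Configuration.ProjectivePlane.card_lines P L
  rw [hq, ← Nat.card_eq_fintype_card] at hL
  have hunion : (B.lines ∪ E).ncard ≤ Nat.card L := Set.ncard_le_card _
  have hsum := Set.ncard_union_add_ncard_inter B.lines E
  rw [hB.ncard_lines] at hsum
  lia
end
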